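/- arXiv:1511.06177 — 7 statements merged into one kernel-verified Lean document; each statement's English description precedes it below -/
import Mathlib

section
/- Let a, k, m, n be positive integers with a odd. Then N(a,a,2k,2m;2n) = N(a,a,k,m;n). -/
/-- `N a b c d n` : number of integer quadruples `(x,y,z,w)` with
`n = a*x^2 + b*y^2 + c*z^2 + d*w^2`. -/
noncomputable def N (a b c d : ℕ) (n : ℕ) : ℕ :=
  Set.ncard {P : ℤ × ℤ × ℤ × ℤ |
    (n : ℤ) = a * P.1 ^ 2 + b * P.2.1 ^ 2 + c * P.2.2.1 ^ 2 + d * P.2.2.2 ^ 2}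

/-- `t a b c d n` : number of integer quadruples `(x,y,z,w)` with
`n = a*x(x-1)/2 + b*y(y-1)/2 + c*z(z-1)/2 + d*w(w-1)/2`. -/
noncomputable def t (a b c d : ℕ) (n : ℕ) : ℕ :=
  Set.ncard {P : ℤ × ℤ × ℤ × ℤ |
    (n : ℤ) = a * (P.1 * (P.1 - 1) / 2) + b * (P.2.1 * (P.2.1 - 1) / 2)
      + c * (P.2.2.1 * (P.2.2.1 - 1) / 2) + d * (P.2.2.2 * (P.2.2.2 - 1) / 2)}

theorem stmt0 (a k m n : ℕ) (ha : 0 < a) (hk : 0 < k) (hm : 0 < m) (hn : 0 < n)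
    (haodd : Odd a) :
    N a a (2 * k) (2 * m) (2 * n) = N a a k m n := by
  unfold N
  have himg : {P : ℤ × ℤ × ℤ × ℤ |
      ((2 * n : ℕ) : ℤ) = a * P.1 ^ 2 + a * P.2.1 ^ 2 + ((2 * k : ℕ) : ℤ) * P.2.2.1 ^ 2
        + ((2 * m : ℕ) : ℤ) * P.2.2.2 ^ 2}
      = (fun P : ℤ × ℤ × ℤ × ℤ => (P.1 + P.2.1, P.1 - P.2.1, P.2.2.1, P.2.2.2)) ''
        {P : ℤ × ℤ × ℤ × ℤ |
          (n : ℤ) = a * P.1 ^ 2 + a * P.2.1 ^ 2 + k * P.2.2.1 ^ 2 + m * P.2.2.2 ^ 2} := by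
    ext ⟨x, y, z, w⟩
    simp only [Set.mem_ofPred_eq, Set.mem_image, Prod.exists, Prod.mk.injEq]
    push_cast
    constructor
    · intro h
      have he : Even ((a : ℤ) * (x ^ 2 + y ^ 2)) :=
        ⟨n - k * z ^ 2 - m * w ^ 2, by linarith⟩
      have hao : ¬ Even (a : ℤ) := by
        rw [Int.not_even_iff_odd]; exact_mod_cast haodd
      have h2 : Even (x + y) := by
        rcases Int.even_mul.1 he with h1 | h1
        · exact absurd h1 hao
        · simpa [Int.even_add, Int.even_pow] using h1
      obtain ⟨u, hu⟩ := h2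
      obtain rfl : y = u + u - x := by linarith
      refine ⟨u, x - u, ?_, by ring, by ring, rfl, rfl⟩
      linarith
    · rintro ⟨u, v, h, rfl, rfl, -, -⟩
      rw [h]; ring
  rw [himg]
  apply Set.ncard_image_of_injective
  rintro ⟨x, y, z, w⟩ ⟨x', y', z', w'⟩ h
  simp only [Prod.mk.injEq] at h ⊢
  obtain ⟨h1, h2, h3, h4⟩ := h
  exact ⟨by linarith, by linarith, h3, h4⟩
end

section
/- Let a be an odd positive integer and m a nonnegative integer. For every positive integer n, t(a,a,2a,8m+4;n) = (2/3)·(N(a,a,a,4m+2; 4n+4m+2a+2) − N(a,a,a,4m+2; n+m+(a+1)/2)) and also t(a,a,2a,8m+4;n) = (2/3)·(N(a,a,2a,8m+4; 8n+8m+4a+4) − N(a,a,2a,8m+4; 2n+2m+a+1)). -/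
def S (a b c d M : ℤ) : Set (ℤ × ℤ × ℤ × ℤ) :=
  {P | M = a * P.1 ^ 2 + b * P.2.1 ^ 2 + c * P.2.2.1 ^ 2 + d * P.2.2.2 ^ 2}

def rotF (P : ℤ × ℤ × ℤ × ℤ) : ℤ × ℤ × ℤ × ℤ := (P.1 + P.2.1, P.1 - P.2.1, P.2.2.1, P.2.2.2)

def dblF (P : ℤ × ℤ × ℤ × ℤ) : ℤ × ℤ × ℤ × ℤ := (2 * P.1, 2 * P.2.1, 2 * P.2.2.1, 2 * P.2.2.2)

def oddF (P : ℤ × ℤ × ℤ × ℤ) : ℤ × ℤ × ℤ × ℤ :=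
  (2 * P.1 - 1, 2 * P.2.1 - 1, 2 * P.2.2.1 - 1, 2 * P.2.2.2 - 1)

def swapA (P : ℤ × ℤ × ℤ × ℤ) : ℤ × ℤ × ℤ × ℤ := (P.2.1, P.1, P.2.2.1, P.2.2.2)

def swapB (P : ℤ × ℤ × ℤ × ℤ) : ℤ × ℤ × ℤ × ℤ := (P.2.2.1, P.2.1, P.1, P.2.2.2)

lemma rotF_inj : Function.Injective rotF := by
  rintro ⟨x, y, z, w⟩ ⟨x', y', z', w'⟩ h
  simp only [rotF, Prod.mk.injEq] at h ⊢
  omega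

lemma dblF_inj : Function.Injective dblF := by
  rintro ⟨x, y, z, w⟩ ⟨x', y', z', w'⟩ h
  simp only [dblF, Prod.mk.injEq] at h ⊢
  omega

lemma oddF_inj : Function.Injective oddF := by
  rintro ⟨x, y, z, w⟩ ⟨x', y', z', w'⟩ h
  simp only [oddF, Prod.mk.injEq] at h ⊢
  omega

lemma swapA_inj : Function.Injective swapA := by
  rintro ⟨x, y, z, w⟩ ⟨x', y', z', w'⟩ h
  simp only [swapA, Prod.mk.injEq] at h ⊢
  omega

lemma swapB_inj : Function.Injective swapB := by
  rintro ⟨x, y, z, w⟩ ⟨x', y', z', w'⟩ h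
  simp only [swapB, Prod.mk.injEq] at h ⊢
  omega

lemma S_finite (a d M : ℤ) (ha : 0 < a) (hd : 0 < d) : (S a a a d M).Finite := by
  refine Set.Finite.subset (s := Set.Icc (-M) M ×ˢ Set.Icc (-M) M ×ˢ Set.Icc (-M) M ×ˢ Set.Icc (-M) M)
    ((Set.finite_Icc _ _).prod ((Set.finite_Icc _ _).prod ((Set.finite_Icc _ _).prod (Set.finite_Icc _ _)))) ?_
  rintro ⟨x, y, z, w⟩ h
  simp only [S, Set.mem_ofPred_eq] at h
  have key : ∀ c u : ℤ, 0 < c → u ^ 2 ≤ c * u ^ 2 := fun c u hc => by nlinarith [sq_nonneg u]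
  have hx := key a x ha
  have hy := key a y ha
  have hz := key a z ha
  have hw := key d w hd
  have k2 : ∀ u : ℤ, u ^ 2 ≤ M → -M ≤ u ∧ u ≤ M := by
    intro u hu
    have h1 := Int.le_self_sq u
    have h2 := Int.le_self_sq (-u)
    rw [neg_sq] at h2
    omega
  have := sq_nonneg x
  have := sq_nonneg y
  have := sq_nonneg z
  have := sq_nonneg w
  simp only [Set.mem_prod, Set.mem_Icc]
  exact ⟨k2 x (by linarith), k2 y (by linarith), k2 z (by linarith), k2 w (by linarith)⟩

lemma par (x : ℤ) : (∃ k, x = 2 * k) ∨ (∃ k, x = 2 * k + 1) := by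
  rcases Int.even_or_odd x with ⟨k, h⟩ | ⟨k, h⟩
  · left; exact ⟨k, by omega⟩
  · right; exact ⟨k, h⟩

lemma rot_S (k d M : ℤ) : S (2*k+1) (2*k+1) (2 * (2*k+1)) (2 * d) (2 * M) = rotF '' S (2*k+1) (2*k+1) (2*k+1) d M := by
  ext ⟨x, y, z, w⟩
  simp only [S, rotF, Set.mem_image, Set.mem_ofPred_eq, Prod.mk.injEq, Prod.exists]
  constructor
  · intro h
    have hp : (x + y) % 2 = 0 := by
      rcases par x with ⟨p, rfl⟩ | ⟨p, rfl⟩ <;> rcases par y with ⟨q, rfl⟩ | ⟨q, rfl⟩ <;> ring_nf at h ⊢ <;> omega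
    obtain ⟨u, hu⟩ : ∃ u, x + y = 2 * u := ⟨(x+y)/2, by omega⟩
    obtain rfl : y = 2 * u - x := by omega
    refine ⟨u, x - u, z, w, ?_, by ring, by ring, rfl, rfl⟩
    have : 2 * M = 2 * ((2*k+1) * u ^ 2 + (2*k+1) * (x-u) ^ 2 + (2*k+1) * z ^ 2 + d * w ^ 2) := by
      rw [h]; ring
    linarith
  · rintro ⟨u, v, z', w', h, rfl, rfl, rfl, rfl⟩
    rw [h]; ring

/-- odd parts -/
def O (a d M : ℤ) (i j l : ℤ) : Set (ℤ × ℤ × ℤ × ℤ) :=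
  {P | P ∈ S a a a d M ∧ P.1 % 2 = i ∧ P.2.1 % 2 = j ∧ P.2.2.1 % 2 = l ∧ P.2.2.2 % 2 = 1}

lemma O_swapA (a d M i j l : ℤ) : O a d M j i l = swapA '' O a d M i j l := by
  ext ⟨x, y, z, w⟩
  simp only [O, S, swapA, Set.mem_image, Set.mem_ofPred_eq, Prod.mk.injEq, Prod.exists]
  constructor
  · rintro ⟨h, h1, h2, h3, h4⟩
    exact ⟨y, x, z, w, ⟨by rw [h]; ring, h2, h1, h3, h4⟩, rfl, rfl, rfl, rfl⟩
  · rintro ⟨y, x, z, w, ⟨h, h1, h2, h3, h4⟩, rfl, rfl, rfl, rfl⟩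
    exact ⟨by rw [h]; ring, h2, h1, h3, h4⟩

lemma O_swapB (a d M i j l : ℤ) : O a d M l j i = swapB '' O a d M i j l := by
  ext ⟨x, y, z, w⟩
  simp only [O, S, swapB, Set.mem_image, Set.mem_ofPred_eq, Prod.mk.injEq, Prod.exists]
  constructor
  · rintro ⟨h, h1, h2, h3, h4⟩
    exact ⟨z, y, x, w, ⟨by rw [h]; ring, h3, h2, h1, h4⟩, rfl, rfl, rfl, rfl⟩
  · rintro ⟨z, y, x, w, ⟨h, h1, h2, h3, h4⟩, rfl, rfl, rfl, rfl⟩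
    exact ⟨by rw [h]; ring, h3, h2, h1, h4⟩

lemma mod4 (k m M x y z w : ℤ)
    (h : 4 * M = (2*k+1) * x ^ 2 + (2*k+1) * y ^ 2 + (2*k+1) * z ^ 2 + (4*m+2) * w ^ 2) :
    (x % 2 = 0 ∧ y % 2 = 0 ∧ z % 2 = 0 ∧ w % 2 = 0) ∨
    (x % 2 = 0 ∧ y % 2 = 1 ∧ z % 2 = 1 ∧ w % 2 = 1) ∨
    (x % 2 = 1 ∧ y % 2 = 0 ∧ z % 2 = 1 ∧ w % 2 = 1) ∨
    (x % 2 = 1 ∧ y % 2 = 1 ∧ z % 2 = 0 ∧ w % 2 = 1) := by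
  rcases par x with ⟨p, rfl⟩ | ⟨p, rfl⟩ <;> rcases par y with ⟨q, rfl⟩ | ⟨q, rfl⟩ <;>
  rcases par z with ⟨r, rfl⟩ | ⟨r, rfl⟩ <;> rcases par w with ⟨s, rfl⟩ | ⟨s, rfl⟩ <;>
  first
  | omega
  | (exfalso; ring_nf at h; omega)

lemma S_decomp (k m M : ℤ) : S (2*k+1) (2*k+1) (2*k+1) (4*m+2) (4*M) =
    dblF '' S (2*k+1) (2*k+1) (2*k+1) (4*m+2) M ∪ (O (2*k+1) (4*m+2) (4*M) 0 1 1 ∪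
      (O (2*k+1) (4*m+2) (4*M) 1 0 1 ∪ O (2*k+1) (4*m+2) (4*M) 1 1 0)) := by
  ext ⟨x, y, z, w⟩
  simp only [O, S, dblF, Set.mem_union, Set.mem_image, Set.mem_ofPred_eq, Prod.mk.injEq, Prod.exists]
  constructor
  · intro h
    rcases mod4 k m M x y z w h with h' | h' | h' | h'
    · left
      refine ⟨x/2, y/2, z/2, w/2, ?_, by omega, by omega, by omega, by omega⟩
      obtain ⟨p, rfl⟩ : ∃ p, x = 2 * p := ⟨x/2, by omega⟩
      obtain ⟨q, rfl⟩ : ∃ p, y = 2 * p := ⟨y/2, by omega⟩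
      obtain ⟨r, rfl⟩ : ∃ p, z = 2 * p := ⟨z/2, by omega⟩
      obtain ⟨s, rfl⟩ : ∃ p, w = 2 * p := ⟨w/2, by omega⟩
      simp only [Int.mul_ediv_cancel_left _ (two_ne_zero)]
      linarith
    · right; left; exact ⟨h, h'⟩
    · right; right; left; exact ⟨h, h'⟩
    · right; right; right; exact ⟨h, h'⟩
  · rintro (⟨x, y, z, w, h, rfl, rfl, rfl, rfl⟩ | h | h | h)
    · rw [h]; ring
    · exact h.1
    · exact h.1
    · exact h.1

lemma disj_O (a d M i j l i' j' l' : ℤ) (h : i ≠ i' ∨ j ≠ j' ∨ l ≠ l') :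
    Disjoint (O a d M i j l) (O a d M i' j' l') := by
  rw [Set.disjoint_left]
  rintro ⟨x, y, z, w⟩ ⟨-, h1⟩ ⟨-, h2⟩
  simp only at h1 h2
  omega

lemma O_finite (a d M i j l : ℤ) (ha : 0 < a) (hd : 0 < d) : (O a d M i j l).Finite :=
  (S_finite a d M ha hd).subset fun _ h => h.1

lemma O_card (a d M : ℤ) : (O a d M 1 0 1).ncard = (O a d M 0 1 1).ncard ∧
    (O a d M 1 1 0).ncard = (O a d M 0 1 1).ncard := by
  constructor
  · rw [O_swapA a d M 0 1 1, Set.ncard_image_of_injective _ swapA_inj]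
  · rw [O_swapB a d M 0 1 1, Set.ncard_image_of_injective _ swapB_inj]

lemma S_card (k m M : ℤ) (hk : 0 ≤ k) (hm : 0 ≤ m) :
    (S (2*k+1) (2*k+1) (2*k+1) (4*m+2) (4*M)).ncard =
    (S (2*k+1) (2*k+1) (2*k+1) (4*m+2) M).ncard + 3 * (O (2*k+1) (4*m+2) (4*M) 0 1 1).ncard := by
  have ha : 0 < 2*k+1 := by omega
  have hd : 0 < 4*m+2 := by omega
  have f1 := O_finite (2*k+1) (4*m+2) (4*M) 0 1 1 ha hd
  have f2 := O_finite (2*k+1) (4*m+2) (4*M) 1 0 1 ha hd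
  have f3 := O_finite (2*k+1) (4*m+2) (4*M) 1 1 0 ha hd
  have c := O_card (2*k+1) (4*m+2) (4*M)
  rw [S_decomp, Set.ncard_union_eq _ ((S_finite _ _ _ ha hd).image _) (f1.union (f2.union f3)),
    Set.ncard_union_eq _ f1 (f2.union f3), Set.ncard_union_eq _ f2 f3,
    Set.ncard_image_of_injective _ dblF_inj, c.1, c.2]
  · ring
  · exact disj_O _ _ _ _ _ _ _ _ _ (by simp)
  · rw [Set.disjoint_union_right]
    exact ⟨disj_O _ _ _ _ _ _ _ _ _ (by simp), disj_O _ _ _ _ _ _ _ _ _ (by simp)⟩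
  · rw [Set.disjoint_left]
    rintro P ⟨⟨x, y, z, w⟩, -, rfl⟩ h
    simp only [O, dblF, Set.mem_union, Set.mem_ofPred_eq] at h
    omega

def T (a d M : ℤ) : Set (ℤ × ℤ × ℤ × ℤ) :=
  {P | M = a * (P.1 * (P.1 - 1) / 2) + a * (P.2.1 * (P.2.1 - 1) / 2)
      + 2 * a * (P.2.2.1 * (P.2.2.1 - 1) / 2) + d * (P.2.2.2 * (P.2.2.2 - 1) / 2)}

lemma tri (x : ℤ) : (2 * x - 1) ^ 2 = 8 * (x * (x - 1) / 2) + 1 := by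
  have h : 2 * (x * (x - 1) / 2) = x * (x - 1) :=
    Int.mul_ediv_cancel' (Int.even_mul_pred_self x).two_dvd
  linarith

lemma T_image (k m n : ℤ) : oddF '' T (2*k+1) (8*m+4) n =
    rotF '' (O (2*k+1) (4*m+2) (4*(n+m+k+1)) 0 1 1 ∪ O (2*k+1) (4*m+2) (4*(n+m+k+1)) 1 0 1) := by
  ext ⟨x, y, z, w⟩
  simp only [T, O, S, oddF, rotF, Set.mem_union, Set.mem_image, Set.mem_ofPred_eq, Prod.mk.injEq, Prod.exists]
  constructor
  · rintro ⟨x, y, z, w, h, rfl, rfl, rfl, rfl⟩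
    have hx := tri x
    have hy := tri y
    have hz := tri z
    have hw := tri w
    refine ⟨x + y - 1, x - y, 2*z-1, 2*w-1, ?_, by ring, by ring, rfl, rfl⟩
    have e : 4*(n+m+k+1) = (2*k+1) * (x+y-1)^2 + (2*k+1) * (x-y)^2 + (2*k+1) * (2*z-1)^2
        + (4*m+2) * (2*w-1)^2 := by
      have e1 : 2 * ((x+y-1)^2 + (x-y)^2) = (2*x-1)^2 + (2*y-1)^2 := by ring
      have e2 : (x+y-1)^2 + (x-y)^2 = 4 * (x * (x - 1) / 2) + 4 * (y * (y - 1) / 2) + 1 := by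
        linarith
      rw [add_assoc, add_assoc, ← add_assoc, ← mul_add, e2, hz, hw, h]
      ring
    have : (x + y - 1) % 2 = 0 ∧ (x-y) % 2 = 1 ∨ (x + y - 1) % 2 = 1 ∧ (x-y) % 2 = 0 := by omega
    rcases this with ⟨h1, h2⟩ | ⟨h1, h2⟩
    · left; exact ⟨e, h1, h2, by omega, by omega⟩
    · right; exact ⟨e, h1, h2, by omega, by omega⟩
  · rintro ⟨u, v, z, w, h, rfl, rfl, rfl, rfl⟩
    have h' : 4*(n+m+k+1) = (2*k+1) * u^2 + (2*k+1) * v^2 + (2*k+1) * z^2 + (4*m+2) * w^2 := by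
      rcases h with h | h <;> exact h.1
    have h2 : (u + v) % 2 = 1 ∧ z % 2 = 1 ∧ w % 2 = 1 := by omega
    obtain ⟨p, hp⟩ : ∃ p, u + v = 2 * p - 1 := ⟨(u+v+1)/2, by omega⟩
    obtain ⟨q, hq⟩ : ∃ q, u - v = 2 * q - 1 := ⟨(u-v+1)/2, by omega⟩
    obtain ⟨r, rfl⟩ : ∃ q, z = 2 * q - 1 := ⟨(z+1)/2, by omega⟩
    obtain ⟨s, rfl⟩ : ∃ q, w = 2 * q - 1 := ⟨(w+1)/2, by omega⟩
    refine ⟨p, q, r, s, ?_, hp.symm, hq.symm, rfl, rfl⟩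
    have e1 : 2 * (u^2 + v^2) = (2*p-1)^2 + (2*q-1)^2 := by rw [← hp, ← hq]; ring
    have e2 : u^2 + v^2 = 4 * (p * (p - 1) / 2) + 4 * (q * (q - 1) / 2) + 1 := by
      linarith [tri p, tri q]
    rw [add_assoc, add_assoc, ← add_assoc, ← mul_add, e2, tri r, tri s] at h'
    linarith

lemma T_card (k m n : ℤ) (hk : 0 ≤ k) (hm : 0 ≤ m) :
    (T (2*k+1) (8*m+4) n).ncard = 2 * (O (2*k+1) (4*m+2) (4*(n+m+k+1)) 0 1 1).ncard := by
  have ha : 0 < 2*k+1 := by omega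
  have hd : 0 < 4*m+2 := by omega
  rw [← Set.ncard_image_of_injective _ oddF_inj, T_image, Set.ncard_image_of_injective _ rotF_inj,
    Set.ncard_union_eq (disj_O _ _ _ _ _ _ _ _ _ (by simp)) (O_finite _ _ _ _ _ _ ha hd)
      (O_finite _ _ _ _ _ _ ha hd), (O_card _ _ _).1]
  ring

lemma N_eq (a b c d n : ℕ) : N a b c d n = (S a b c d n).ncard := rfl

theorem stmt4 (a m : ℕ) (ha : 0 < a) (haodd : Odd a) (n : ℕ) (hn : 0 < n) :
    (t a a (2 * a) (8 * m + 4) n : ℚ)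
      = 2 / 3 * ((N a a a (4 * m + 2) (4 * n + 4 * m + 2 * a + 2) : ℚ)
          - (N a a a (4 * m + 2) (n + m + (a + 1) / 2) : ℚ)) ∧
    (t a a (2 * a) (8 * m + 4) n : ℚ)
      = 2 / 3 * ((N a a (2 * a) (8 * m + 4) (8 * n + 8 * m + 4 * a + 4) : ℚ)
          - (N a a (2 * a) (8 * m + 4) (2 * n + 2 * m + a + 1) : ℚ)) := by
  obtain ⟨k, rfl⟩ := haodd
  have ht : t (2*k+1) (2*k+1) (2 * (2*k+1)) (8 * m + 4) n = (T (2*k+1) (8*m+4) n).ncard := by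
    unfold t T; push_cast; rfl
  have h1 : N (2*k+1) (2*k+1) (2*k+1) (4 * m + 2) (4 * n + 4 * m + 2 * (2*k+1) + 2) =
      (S (2*k+1) (2*k+1) (2*k+1) (4*m+2) (4*(n+m+k+1))).ncard := by
    rw [N_eq]; push_cast; congr 2; ring
  have h2 : N (2*k+1) (2*k+1) (2*k+1) (4 * m + 2) (n + m + (2*k+1+1)/2) =
      (S (2*k+1) (2*k+1) (2*k+1) (4*m+2) (n+m+k+1)).ncard := by
    rw [N_eq, show (2*k+1+1)/2 = k+1 by omega]; push_cast; rfl
  have h3 : N (2*k+1) (2*k+1) (2*(2*k+1)) (8 * m + 4) (8 * n + 8 * m + 4 * (2*k+1) + 4) =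
      (S (2*k+1) (2*k+1) (2*k+1) (4*m+2) (4*(n+m+k+1))).ncard := by
    rw [N_eq, ← Set.ncard_image_of_injective (S (2*k+1) (2*k+1) (2*k+1) _ _) rotF_inj, ← rot_S]; push_cast; congr 2 <;> ring
  have h4 : N (2*k+1) (2*k+1) (2*(2*k+1)) (8 * m + 4) (2 * n + 2 * m + (2*k+1) + 1) =
      (S (2*k+1) (2*k+1) (2*k+1) (4*m+2) (n+m+k+1)).ncard := by
    rw [N_eq, ← Set.ncard_image_of_injective (S (2*k+1) (2*k+1) (2*k+1) _ _) rotF_inj, ← rot_S]; push_cast; congr 2 <;> ring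
  rw [ht, h1, h2, h3, h4, T_card k m n (by positivity) (by positivity),
    S_card k m _ (by positivity) (by positivity)]
  push_cast
  constructor <;> ring
end

section
/- Let a be an odd positive integer, and let k, m be nonnegative integers with k ≡ m (mod 2). For every positive integer n, t(a,3a,4k+2,4m+2;n) = (2/3)·(N(a,3a,4k+2,4m+2; 8n+4m+4k+4a+4) − N(a,3a,4k+2,4m+2; 2n+m+k+a+1)). -/
lemma aux_a (a X : ℤ) (ha : a % 2 = 1) : (X % 2 = 1 ∧ ∃ u, a * X ^ 2 = 8 * u + a) ∨
    (X % 2 = 0 ∧ ∃ u, a * X ^ 2 = 4 * u ∧ (2 * u) % 4 = X % 4) := by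
  rcases Int.even_or_odd' X with ⟨x, h | h⟩
  · right
    refine ⟨by omega, a * x ^ 2, by subst h; ring, ?_⟩
    have : (a * x ^ 2) % 2 = x % 2 := by
      rcases Int.emod_two_eq_zero_or_one x with hx | hx <;>
        simp [Int.mul_emod, pow_two, ha, hx]
    omega
  · left
    refine ⟨by omega, ?_⟩
    obtain ⟨v, hv⟩ := Int.even_mul_succ_self x
    refine ⟨a * v, ?_⟩
    subst h
    linear_combination 4 * a * hv

lemma aux_c (k X : ℤ) : (X % 2 = 1 ∧ ∃ u, (4 * k + 2) * X ^ 2 = 16 * u + (4 * k + 2)) ∨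
    (X % 2 = 0 ∧ ∃ u, (4 * k + 2) * X ^ 2 = 8 * u) := by
  rcases Int.even_or_odd' X with ⟨x, h | h⟩
  · right
    exact ⟨by omega, (2 * k + 1) * x ^ 2, by subst h; ring⟩
  · left
    refine ⟨by omega, ?_⟩
    obtain ⟨v, hv⟩ := Int.even_mul_succ_self x
    refine ⟨(2 * k + 1) * v, ?_⟩
    subst h
    linear_combination 4 * (4 * k + 2) * hv

lemma aux_class (a k m n X Y Z W : ℤ) (ha : a % 2 = 1) (hkm : k % 2 = m % 2)
    (h : 8 * n + 4 * m + 4 * k + 4 * a + 4 = a * X ^ 2 + 3 * a * Y ^ 2 + (4 * k + 2) * Z ^ 2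
      + (4 * m + 2) * W ^ 2) :
    (X % 2 = 0 ∧ Y % 2 = 0 ∧ Z % 2 = 0 ∧ W % 2 = 0) ∨
    (X % 2 = 0 ∧ (X + Y) % 4 = 2 ∧ Z % 2 = 1 ∧ W % 2 = 1) ∨
    (X % 2 = 1 ∧ Y % 2 = 1 ∧ Z % 2 = 1 ∧ W % 2 = 1) := by
  rw [mul_assoc 3 a] at h
  rcases aux_a a X ha with ⟨hX, u, hu⟩ | ⟨hX, u, hu, hu'⟩ <;>
  rcases aux_a a Y ha with ⟨hY, v, hv⟩ | ⟨hY, v, hv, hv'⟩ <;>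
  rcases aux_c k Z with ⟨hZ, p, hp⟩ | ⟨hZ, p, hp⟩ <;>
  rcases aux_c m W with ⟨hW, q, hq⟩ | ⟨hW, q, hq⟩ <;>
  rw [hu, hv, hp, hq] at h <;> omega

lemma aux_fin (a b c d n : ℤ) (ha : 0 < a) (hb : 0 < b) (hc : 0 < c) (hd : 0 < d) :
    {P : ℤ × ℤ × ℤ × ℤ | n = a * P.1 ^ 2 + b * P.2.1 ^ 2 + c * P.2.2.1 ^ 2
      + d * P.2.2.2 ^ 2}.Finite := by
  have key : ∀ e x : ℤ, 0 < e → e * x ^ 2 ≤ n → x ∈ Set.Icc (-n) n := by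
    intro e x he hx
    have h1 : x ^ 2 ≤ n := by nlinarith [sq_nonneg x]
    constructor
    · nlinarith [sq_nonneg x, Int.le_self_sq (-x)]
    · nlinarith [Int.le_self_sq x]
  apply Set.Finite.subset (((Set.finite_Icc (-n) n).prod ((Set.finite_Icc (-n) n).prod
    ((Set.finite_Icc (-n) n).prod (Set.finite_Icc (-n) n)))))
  rintro ⟨x, y, z, w⟩ h
  simp only [Set.mem_ofPred_eq] at h
  have h1 : 0 ≤ a * x ^ 2 := by positivity
  have h2 : 0 ≤ b * y ^ 2 := by positivity
  have h3 : 0 ≤ c * z ^ 2 := by positivity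
  have h4 : 0 ≤ d * w ^ 2 := by positivity
  exact ⟨key a x ha (by linarith), key b y hb (by linarith), key c z hc (by linarith),
    key d w hd (by linarith)⟩

lemma aux_tri (x : ℤ) : 8 * (x * (x - 1) / 2) + 1 = (2 * x - 1) ^ 2 := by
  have h : x * (x - 1) / 2 * 2 = x * (x - 1) :=
    Int.ediv_mul_cancel (Int.even_mul_pred_self x).two_dvd
  linear_combination 4 * h

theorem stmt5 (a k m : ℕ) (ha : 0 < a) (haodd : Odd a) (hkm : k % 2 = m % 2)
    (n : ℕ) (hn : 0 < n) :
    (t a (3 * a) (4 * k + 2) (4 * m + 2) n : ℚ)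
      = 2 / 3 * ((N a (3 * a) (4 * k + 2) (4 * m + 2) (8 * n + 4 * m + 4 * k + 4 * a + 4) : ℚ)
          - (N a (3 * a) (4 * k + 2) (4 * m + 2) (2 * n + m + k + a + 1) : ℚ)) := by
  have ha2 : (a : ℤ) % 2 = 1 := by have := Nat.odd_iff.mp haodd; omega
  have hkm' : (k : ℤ) % 2 = (m : ℤ) % 2 := by omega
  set S : Set (ℤ × ℤ × ℤ × ℤ) := {P | 8 * (n:ℤ) + 4 * m + 4 * k + 4 * a + 4
    = a * P.1 ^ 2 + 3 * a * P.2.1 ^ 2 + (4 * k + 2) * P.2.2.1 ^ 2 + (4 * m + 2) * P.2.2.2 ^ 2}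
    with hS
  have hSfin : S.Finite := by
    apply aux_fin <;> positivity
  set E := S ∩ {P | P.1 % 2 = 0 ∧ P.2.1 % 2 = 0 ∧ P.2.2.1 % 2 = 0 ∧ P.2.2.2 % 2 = 0} with hE
  set B := S ∩ {P | P.1 % 2 = 0 ∧ (P.1 + P.2.1) % 4 = 2 ∧ P.2.2.1 % 2 = 1 ∧ P.2.2.2 % 2 = 1}
    with hB
  set O := S ∩ {P | P.1 % 2 = 1 ∧ P.2.1 % 2 = 1 ∧ P.2.2.1 % 2 = 1 ∧ P.2.2.2 % 2 = 1} with hO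
  set O1 := O ∩ {P | (P.1 - P.2.1) % 4 = 0} with hO1
  set O2 := O ∩ {P | (P.1 + P.2.1) % 4 = 0} with hO2
  have fE : E.Finite := hSfin.subset Set.inter_subset_left
  have fB : B.Finite := hSfin.subset Set.inter_subset_left
  have fO : O.Finite := hSfin.subset Set.inter_subset_left
  have f1 : O1.Finite := fO.subset Set.inter_subset_left
  have f2 : O2.Finite := fO.subset Set.inter_subset_left
  have hSu : S = E ∪ (B ∪ O) := by
    ext ⟨x, y, z, w⟩
    constructor
    · intro h
      rcases aux_class a k m n x y z w ha2 hkm' h with h' | h' | h'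
      · exact Or.inl ⟨h, h'⟩
      · exact Or.inr (Or.inl ⟨h, h'⟩)
      · exact Or.inr (Or.inr ⟨h, h'⟩)
    · rintro (h | h | h) <;> exact h.1
  have cS : S.ncard = E.ncard + (B.ncard + O.ncard) := by
    rw [hSu, Set.ncard_union_eq _ fE (fB.union fO), Set.ncard_union_eq _ fB fO]
    · rw [Set.disjoint_left]
      rintro P ⟨_, h⟩ ⟨_, h'⟩
      simp only [Set.mem_ofPred_eq] at h h'
      omega
    · rw [Set.disjoint_left]
      rintro P ⟨_, h⟩ (⟨_, h'⟩ | ⟨_, h'⟩) <;>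
      · simp only [Set.mem_ofPred_eq] at h h'
        omega
  have hOu : O = O1 ∪ O2 := by
    ext P
    constructor
    · intro h
      have h' := h.2
      simp only [Set.mem_ofPred_eq] at h'
      have : (P.1 - P.2.1) % 4 = 0 ∨ (P.1 + P.2.1) % 4 = 0 := by omega
      rcases this with h'' | h''
      · exact Or.inl ⟨h, h''⟩
      · exact Or.inr ⟨h, h''⟩
    · rintro (h | h) <;> exact h.1
  have cO : O.ncard = O1.ncard + O2.ncard := by
    rw [hOu, Set.ncard_union_eq _ f1 f2]
    rw [Set.disjoint_left]
    rintro P ⟨⟨_, h⟩, h1⟩ ⟨_, h2⟩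
    simp only [Set.mem_ofPred_eq] at h h1 h2
    omega
  have c12 : O1.ncard = O2.ncard := by
    refine Set.ncard_congr (fun P _ => (P.1, -P.2.1, P.2.2.1, P.2.2.2)) ?_ ?_ ?_
    · rintro ⟨x, y, z, w⟩ ⟨⟨h, h'⟩, h''⟩
      simp only [hS, Set.mem_ofPred_eq] at h h' h''
      refine ⟨⟨?_, ?_⟩, ?_⟩ <;> simp only [hS, Set.mem_ofPred_eq]
      · rw [h]; ring
      · omega
      · omega
    · rintro ⟨x, y, z, w⟩ ⟨x', y', z', w'⟩ _ _ h
      simpa using h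
    · rintro ⟨x, y, z, w⟩ ⟨⟨h, h'⟩, h''⟩
      simp only [hS, Set.mem_ofPred_eq] at h h' h''
      refine ⟨(x, -y, z, w), ⟨⟨?_, ?_⟩, ?_⟩, ?_⟩ <;> simp only [hS, Set.mem_ofPred_eq]
      · rw [h]; ring
      · omega
      · omega
      · simp
  have c1B : O1.ncard = B.ncard := by
    refine Set.ncard_congr (fun P _ => ((P.1 + 3 * P.2.1) / 2, (P.1 - P.2.1) / 2,
      P.2.2.1, P.2.2.2)) ?_ ?_ ?_
    · rintro ⟨x, y, z, w⟩ ⟨⟨h, h'⟩, h''⟩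
      simp only [hS, Set.mem_ofPred_eq] at h h' h''
      obtain ⟨u, rfl⟩ : ∃ u, x = y + 4 * u := ⟨(x - y) / 4, by omega⟩
      have e1 : (y + 4 * u + 3 * y) / 2 = 2 * y + 2 * u := by omega
      have e2 : (y + 4 * u - y) / 2 = 2 * u := by omega
      refine ⟨?_, ?_⟩ <;> simp only [hS, Set.mem_ofPred_eq, e1, e2]
      · rw [h]; ring
      · omega
    · rintro ⟨x, y, z, w⟩ ⟨x', y', z', w'⟩ ⟨⟨_, h1⟩, h2⟩ ⟨⟨_, h3⟩, h4⟩ h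
      simp only [Set.mem_ofPred_eq, Prod.mk.injEq] at h h1 h2 h3 h4 ⊢
      omega
    · rintro ⟨x, y, z, w⟩ ⟨h, h'⟩
      simp only [hS, Set.mem_ofPred_eq] at h h'
      obtain ⟨u, rfl⟩ : ∃ u, x = 2 * u := ⟨x / 2, by omega⟩
      obtain ⟨v, rfl⟩ : ∃ v, y = 2 * v := ⟨y / 2, by omega⟩
      refine ⟨(u + 3 * v, u - v, z, w), ⟨⟨?_, ?_⟩, ?_⟩, ?_⟩ <;>
        simp only [hS, Set.mem_ofPred_eq, Prod.mk.injEq, and_true]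
      · rw [h]; ring
      · omega
      · omega
      · omega
  have cN4 : N a (3 * a) (4 * k + 2) (4 * m + 2) (8 * n + 4 * m + 4 * k + 4 * a + 4)
      = S.ncard := by
    unfold N
    push_cast
    rfl
  have cN1 : N a (3 * a) (4 * k + 2) (4 * m + 2) (2 * n + m + k + a + 1) = E.ncard := by
    unfold N
    push_cast
    refine Set.ncard_congr (fun P _ => (2 * P.1, 2 * P.2.1, 2 * P.2.2.1, 2 * P.2.2.2)) ?_ ?_ ?_
    · rintro ⟨x, y, z, w⟩ h
      simp only [Set.mem_ofPred_eq] at h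
      refine ⟨?_, ?_⟩ <;> simp only [hS, Set.mem_ofPred_eq]
      · linear_combination 4 * h
      · omega
    · rintro ⟨x, y, z, w⟩ ⟨x', y', z', w'⟩ _ _ h
      simpa using h
    · rintro ⟨x, y, z, w⟩ ⟨h, h'⟩
      simp only [hS, Set.mem_ofPred_eq] at h h'
      obtain ⟨x, rfl⟩ : ∃ u, x = 2 * u := ⟨x / 2, by omega⟩
      obtain ⟨y, rfl⟩ : ∃ u, y = 2 * u := ⟨y / 2, by omega⟩
      obtain ⟨z, rfl⟩ : ∃ u, z = 2 * u := ⟨z / 2, by omega⟩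
      obtain ⟨w, rfl⟩ : ∃ u, w = 2 * u := ⟨w / 2, by omega⟩
      refine ⟨(x, y, z, w), ?_, rfl⟩
      simp only [Set.mem_ofPred_eq]
      have : (4 : ℤ) ≠ 0 := by norm_num
      apply mul_left_cancel₀ this
      linear_combination h
  have ct : t a (3 * a) (4 * k + 2) (4 * m + 2) n = O.ncard := by
    unfold t
    push_cast
    refine Set.ncard_congr (fun P _ => (2 * P.1 - 1, 2 * P.2.1 - 1, 2 * P.2.2.1 - 1,
      2 * P.2.2.2 - 1)) ?_ ?_ ?_
    · rintro ⟨x, y, z, w⟩ h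
      simp only [Set.mem_ofPred_eq] at h
      refine ⟨?_, ?_⟩ <;> simp only [hS, Set.mem_ofPred_eq]
      · rw [← aux_tri x, ← aux_tri y, ← aux_tri z, ← aux_tri w]
        linear_combination 8 * h
      · omega
    · rintro ⟨x, y, z, w⟩ ⟨x', y', z', w'⟩ _ _ h
      simpa using h
    · rintro ⟨x, y, z, w⟩ ⟨h, h'⟩
      simp only [hS, Set.mem_ofPred_eq] at h h'
      obtain ⟨x, rfl⟩ : ∃ u, x = 2 * u - 1 := ⟨(x + 1) / 2, by omega⟩
      obtain ⟨y, rfl⟩ : ∃ u, y = 2 * u - 1 := ⟨(y + 1) / 2, by omega⟩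
      obtain ⟨z, rfl⟩ : ∃ u, z = 2 * u - 1 := ⟨(z + 1) / 2, by omega⟩
      obtain ⟨w, rfl⟩ : ∃ u, w = 2 * u - 1 := ⟨(w + 1) / 2, by omega⟩
      refine ⟨(x, y, z, w), ?_, rfl⟩
      simp only [Set.mem_ofPred_eq]
      rw [← aux_tri x, ← aux_tri y, ← aux_tri z, ← aux_tri w] at h
      have : (8 : ℤ) ≠ 0 := by norm_num
      apply mul_left_cancel₀ this
      linear_combination h
  rw [cN4, cN1, ct, cS, cO, ← c12, c1B]
  push_cast
  ring
end

section
/- For every positive integer n, N(2,2,3,9; 8n+6) = (3/5)·N(1,1,3,9; 8n+6). -/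
abbrev Z4 := ℤ × ℤ × ℤ × ℤ

theorem cardEq {s t : Set Z4} (f : Z4 → Z4) (hf : ∀ p ∈ s, f p ∈ t)
    (hi : ∀ p q, f p = f q → p = q) (hs : ∀ q ∈ t, ∃ p ∈ s, f p = q) :
    t.ncard = s.ncard := by
  have : f '' s = t := by
    ext q
    constructor
    · rintro ⟨p, hp, rfl⟩
      exact hf p hp
    · intro hq
      obtain ⟨p, hp, h⟩ := hs q hq
      exact ⟨p, hp, h⟩
  rw [← this]
  exact Set.ncard_image_of_injective s (fun p q h => hi p q h)

theorem sqOdd (x : ℤ) (h : x % 2 = 1) : x ^ 2 % 8 = 1 := by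
  have : x % 8 = 1 ∨ x % 8 = 3 ∨ x % 8 = 5 ∨ x % 8 = 7 := by omega
  rcases this with h | h | h | h <;> simp [pow_two, Int.mul_emod, h]

theorem sqEven (x : ℤ) (h : x % 2 = 0) : x ^ 2 % 4 = 0 := by
  have : x % 4 = 0 ∨ x % 4 = 2 := by omega
  rcases this with h | h <;> simp [pow_two, Int.mul_emod, h]

theorem sqCases (x : ℤ) : (x % 2 = 1 ∧ x ^ 2 % 8 = 1) ∨ (x % 2 = 0 ∧ x ^ 2 % 4 = 0) := by
  rcases Int.emod_two_eq_zero_or_one x with h | h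
  · exact Or.inr ⟨h, sqEven x h⟩
  · exact Or.inl ⟨h, sqOdd x h⟩

def Q (a b c d m : ℤ) : Set Z4 :=
  {P | m = a * P.1 ^ 2 + b * P.2.1 ^ 2 + c * P.2.2.1 ^ 2 + d * P.2.2.2 ^ 2}

theorem bd (x m : ℤ) (h : x ^ 2 ≤ m) : x ∈ Set.Icc (-m) m := by
  constructor <;> nlinarith [sq_nonneg (x - 1), sq_nonneg (x + 1), sq_nonneg x,
    Int.le_self_sq x, Int.le_self_sq (-x)]

theorem Qfin (a b c d m : ℤ) (ha : 0 < a) (hb : 0 < b) (hc : 0 < c) (hd : 0 < d) :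
    (Q a b c d m).Finite := by
  have hF := (Set.finite_Icc (-m) m)
  refine (hF.prod (hF.prod (hF.prod hF))).subset ?_
  rintro ⟨x, y, z, w⟩ h
  simp only [Q, Set.mem_ofPred_eq] at h
  have key : ∀ (k x : ℤ), 0 < k → x ^ 2 ≤ k * x ^ 2 := fun k x hk => by
    nlinarith [sq_nonneg x]
  have h1 := key a x ha
  have h2 := key b y hb
  have h3 := key c z hc
  have h4 := key d w hd
  have := sq_nonneg x
  have := sq_nonneg y
  have := sq_nonneg z
  have := sq_nonneg w
  refine ⟨bd _ _ ?_, bd _ _ ?_, bd _ _ ?_, bd _ _ ?_⟩ <;> dsimp only <;> linarith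

/-- splitting by a predicate -/
theorem split (s : Set Z4) (hs : s.Finite) (p : Z4 → Prop) :
    s.ncard = (s ∩ {x | p x}).ncard + (s ∩ {x | ¬ p x}).ncard := by
  rw [← Set.ncard_union_eq _ (hs.inter_of_left _) (hs.inter_of_left _)]
  · congr 1
    ext x
    simp only [Set.mem_union, Set.mem_inter_iff, Set.mem_ofPred_eq]
    tauto
  · rw [Set.disjoint_left]
    rintro x ⟨_, h⟩ ⟨_, h'⟩
    exact h' h

/-- hexagonal tripling on the last two coordinates -/
theorem hexZW (a m : ℤ) (hodd : ∀ x y z w, (x, y, z, w) ∈ Q a a 12 36 m → (z + w) % 2 = 1)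
    (s : Set Z4) (hs : s = Q a a 3 9 m ∩ {P | P.2.2.1 % 2 = 1 ∧ P.2.2.2 % 2 = 1}) (ha : 0 < a) :
    s.ncard = 2 * (Q a a 12 36 m).ncard := by
  have hfin : s.Finite := by
    rw [hs]; exact (Qfin a a 3 9 m ha ha (by norm_num) (by norm_num)).inter_of_left _
  rw [split s hfin (fun P => (P.2.2.1 - P.2.2.2) % 4 = 0), two_mul]
  subst hs
  congr 1
  · apply cardEq (fun P => (P.1, P.2.1, P.2.2.1 + 3 * P.2.2.2, P.2.2.1 - P.2.2.2))
    · rintro ⟨x, y, z, w⟩ h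
      have := hodd x y z w h
      simp only [Q, Set.mem_ofPred_eq, Set.mem_inter_iff] at h ⊢
      refine ⟨⟨by rw [h]; ring, by omega, by omega⟩, by omega⟩
    · rintro ⟨x, y, z, w⟩ ⟨x', y', z', w'⟩ h
      simp only [Prod.mk.injEq] at h ⊢
      omega
    · rintro ⟨x, y, z, w⟩ h
      simp only [Q, Set.mem_ofPred_eq, Set.mem_inter_iff] at h
      obtain ⟨⟨h1, h2, h3⟩, h4⟩ := h
      obtain ⟨c, hc⟩ : ∃ c, z = w + 4 * c := ⟨(z - w) / 4, by omega⟩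
      subst hc
      refine ⟨(x, y, c + w, c), ?_, ?_⟩
      · simp only [Q, Set.mem_ofPred_eq]; rw [h1]; ring
      · ext <;> dsimp only <;> ring
  · apply cardEq (fun P => (P.1, P.2.1, P.2.2.1 + 3 * P.2.2.2, P.2.2.2 - P.2.2.1))
    · rintro ⟨x, y, z, w⟩ h
      have := hodd x y z w h
      simp only [Q, Set.mem_ofPred_eq, Set.mem_inter_iff] at h ⊢
      refine ⟨⟨by rw [h]; ring, by omega, by omega⟩, by omega⟩
    · rintro ⟨x, y, z, w⟩ ⟨x', y', z', w'⟩ h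
      simp only [Prod.mk.injEq] at h ⊢
      omega
    · rintro ⟨x, y, z, w⟩ h
      simp only [Q, Set.mem_ofPred_eq, Set.mem_inter_iff] at h
      obtain ⟨⟨h1, h2, h3⟩, h4⟩ := h
      obtain ⟨c, hc⟩ : ∃ c, z = -w + 4 * c := ⟨(z + w) / 4, by omega⟩
      subst hc
      refine ⟨(x, y, c - w, c), ?_, ?_⟩
      · simp only [Q, Set.mem_ofPred_eq]; rw [h1]; ring
      · ext <;> dsimp only <;> ring

/-- hexagonal tripling on the middle two coordinates -/
theorem hexYZ (m : ℤ) (hm : m % 8 = 6) :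
    (Q 1 1 3 9 m ∩ {P | P.2.2.1 % 2 = 1 ∧ P.2.2.2 % 2 = 1}).ncard
      = 2 * (Q 1 4 12 9 m).ncard := by
  have hodd : ∀ x y z w, (x, y, z, w) ∈ Q 1 4 12 9 m → (y + z) % 2 = 1 ∧ w % 2 = 1 := by
    intro x y z w h
    simp only [Q, Set.mem_ofPred_eq] at h
    rcases sqCases x with hx | hx <;> rcases sqCases y with hy | hy <;>
    rcases sqCases z with hz | hz <;> rcases sqCases w with hw | hw <;> omega
  have hodd' : ∀ x y z w, (x, y, z, w) ∈ Q 1 1 3 9 m → z % 2 = 1 → w % 2 = 1 → y % 2 = 1 := by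
    intro x y z w h h1 h2
    simp only [Q, Set.mem_ofPred_eq] at h
    rcases sqCases x with hx | hx <;> rcases sqCases y with hy | hy <;>
    rcases sqCases z with hz | hz <;> rcases sqCases w with hw | hw <;> omega
  rw [split _ ((Qfin 1 1 3 9 m (by norm_num) (by norm_num) (by norm_num)
    (by norm_num)).inter_of_left _) (fun P => (P.2.1 - P.2.2.1) % 4 = 0), two_mul]
  congr 1
  · apply cardEq (fun P => (P.1, P.2.1 + 3 * P.2.2.1, P.2.1 - P.2.2.1, P.2.2.2))
    · rintro ⟨x, y, z, w⟩ h
      have := hodd x y z w h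
      simp only [Q, Set.mem_ofPred_eq, Set.mem_inter_iff] at h ⊢
      refine ⟨⟨by rw [h]; ring, by omega, by omega⟩, by omega⟩
    · rintro ⟨x, y, z, w⟩ ⟨x', y', z', w'⟩ h
      simp only [Prod.mk.injEq] at h ⊢
      omega
    · rintro ⟨x, y, z, w⟩ h
      obtain ⟨⟨h1, h2, h3⟩, h4⟩ := h
      have h5 := hodd' x y z w h1 h2 h3
      simp only [Q, Set.mem_ofPred_eq] at h1 h2 h3 h4
      obtain ⟨c, hc⟩ : ∃ c, y = z + 4 * c := ⟨(y - z) / 4, by omega⟩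
      subst hc
      refine ⟨(x, c + z, c, w), ?_, ?_⟩
      · simp only [Q, Set.mem_ofPred_eq]; rw [h1]; ring
      · ext <;> dsimp only <;> ring
  · apply cardEq (fun P => (P.1, P.2.1 + 3 * P.2.2.1, P.2.2.1 - P.2.1, P.2.2.2))
    · rintro ⟨x, y, z, w⟩ h
      have := hodd x y z w h
      simp only [Q, Set.mem_ofPred_eq, Set.mem_inter_iff] at h ⊢
      refine ⟨⟨by rw [h]; ring, by omega, by omega⟩, by omega⟩
    · rintro ⟨x, y, z, w⟩ ⟨x', y', z', w'⟩ h
      simp only [Prod.mk.injEq] at h ⊢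
      omega
    · rintro ⟨x, y, z, w⟩ h
      obtain ⟨⟨h1, h2, h3⟩, h4⟩ := h
      have h5 := hodd' x y z w h1 h2 h3
      simp only [Q, Set.mem_ofPred_eq] at h1 h2 h3 h4
      obtain ⟨c, hc⟩ : ∃ c, y = -z + 4 * c := ⟨(y + z) / 4, by omega⟩
      subst hc
      refine ⟨(x, c - z, c, w), ?_, ?_⟩
      · simp only [Q, Set.mem_ofPred_eq]; rw [h1]; ring
      · ext <;> dsimp only <;> ring

/-- both last coordinates even -/
theorem evenZW (a m : ℤ) :
    (Q a a 3 9 m ∩ {P | P.2.2.1 % 2 = 0 ∧ P.2.2.2 % 2 = 0}).ncard = (Q a a 12 36 m).ncard := by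
  apply cardEq (fun P => (P.1, P.2.1, 2 * P.2.2.1, 2 * P.2.2.2))
  · rintro ⟨x, y, z, w⟩ h
    simp only [Q, Set.mem_ofPred_eq, Set.mem_inter_iff] at h ⊢
    refine ⟨by rw [h]; ring, by omega, by omega⟩
  · rintro ⟨x, y, z, w⟩ ⟨x', y', z', w'⟩ h
    simp only [Prod.mk.injEq] at h ⊢
    omega
  · rintro ⟨x, y, z, w⟩ h
    simp only [Q, Set.mem_ofPred_eq, Set.mem_inter_iff] at h
    obtain ⟨h1, h2, h3⟩ := h
    obtain ⟨b, rfl⟩ : ∃ b, z = 2 * b := ⟨z / 2, by omega⟩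
    obtain ⟨c, rfl⟩ : ∃ c, w = 2 * c := ⟨w / 2, by omega⟩
    refine ⟨(x, y, b, c), ?_, rfl⟩
    simp only [Q, Set.mem_ofPred_eq]; rw [h1]; ring

theorem rot (m : ℤ) (hm : m % 8 = 6) : (Q 1 1 12 36 m).ncard = (Q 2 2 12 36 m).ncard := by
  apply cardEq (fun P => (P.1 + P.2.1, P.1 - P.2.1, P.2.2.1, P.2.2.2))
  · rintro ⟨x, y, z, w⟩ h
    simp only [Q, Set.mem_ofPred_eq] at h ⊢
    rw [h]; ring
  · rintro ⟨x, y, z, w⟩ ⟨x', y', z', w'⟩ h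
    simp only [Prod.mk.injEq] at h ⊢
    omega
  · rintro ⟨x, y, z, w⟩ h
    simp only [Q, Set.mem_ofPred_eq] at h
    have : (x - y) % 2 = 0 := by
      rcases sqCases x with hx | hx <;> rcases sqCases y with hy | hy <;> omega
    obtain ⟨c, hc⟩ : ∃ c, x = y + 2 * c := ⟨(x - y) / 2, by omega⟩
    subst hc
    refine ⟨(y + c, c, z, w), ?_, ?_⟩
    · simp only [Q, Set.mem_ofPred_eq]; rw [h]; ring
    · ext <;> dsimp only <;> ring

theorem N2 (m : ℤ) (hm : m % 8 = 6) : (Q 2 2 3 9 m).ncard = 3 * (Q 2 2 12 36 m).ncard := by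
  have h0 := split _ (Qfin 2 2 3 9 m (by norm_num) (by norm_num) (by norm_num) (by norm_num))
    (fun P => P.2.2.1 % 2 = 0 ∧ P.2.2.2 % 2 = 0)
  have h1 := evenZW 2 m
  have h2 := hexZW 2 m (by
    intro x y z w h
    simp only [Q, Set.mem_ofPred_eq] at h
    rcases sqCases x with hx | hx <;> rcases sqCases y with hy | hy <;>
    rcases sqCases z with hz | hz <;> rcases sqCases w with hw | hw <;> omega)
    (Q 2 2 3 9 m ∩ {P | ¬ (P.2.2.1 % 2 = 0 ∧ P.2.2.2 % 2 = 0)}) (by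
    ext ⟨x, y, z, w⟩
    simp only [Q, Set.mem_ofPred_eq, Set.mem_inter_iff]
    refine and_congr_right fun h => ?_
    rcases sqCases x with hx | hx <;> rcases sqCases y with hy | hy <;>
    rcases sqCases z with hz | hz <;> rcases sqCases w with hw | hw <;> omega) (by norm_num)
  omega

theorem N1 (m : ℤ) (hm : m % 8 = 6) : (Q 1 1 3 9 m).ncard = 5 * (Q 1 1 12 36 m).ncard := by
  have hF := Qfin 1 1 3 9 m (by norm_num) (by norm_num) (by norm_num) (by norm_num)
  have h0 := split _ hF (fun P => P.2.2.1 % 2 = 0 ∧ P.2.2.2 % 2 = 0)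
  have h1 := evenZW 1 m
  have h2 := hexZW 1 m (by
    intro x y z w h
    simp only [Q, Set.mem_ofPred_eq] at h
    rcases sqCases x with hx | hx <;> rcases sqCases y with hy | hy <;>
    rcases sqCases z with hz | hz <;> rcases sqCases w with hw | hw <;> omega)
    _ rfl (by norm_num)
  have h3 := hexYZ m hm
  have h4 := split _ (hF.inter_of_left {P | ¬ (P.2.2.1 % 2 = 0 ∧ P.2.2.2 % 2 = 0)})
    (fun P => P.2.2.1 % 2 = 1 ∧ P.2.2.2 % 2 = 1)
  have h5 : Q 1 1 3 9 m ∩ {P | ¬ (P.2.2.1 % 2 = 0 ∧ P.2.2.2 % 2 = 0)}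
      ∩ {P | P.2.2.1 % 2 = 1 ∧ P.2.2.2 % 2 = 1}
      = Q 1 1 3 9 m ∩ {P | P.2.2.1 % 2 = 1 ∧ P.2.2.2 % 2 = 1} := by
    ext ⟨x, y, z, w⟩
    simp only [Set.mem_ofPred_eq, Set.mem_inter_iff]
    rw [and_assoc]
    refine and_congr_right fun h => ?_
    omega
  rw [h5] at h4
  have h6 := split _ ((hF.inter_of_left {P | ¬ (P.2.2.1 % 2 = 0 ∧ P.2.2.2 % 2 = 0)}).inter_of_left
    {P | ¬ (P.2.2.1 % 2 = 1 ∧ P.2.2.2 % 2 = 1)}) (fun P => P.2.1 % 2 = 0)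
  have par : ∀ x y z w : ℤ, m = 1 * x ^ 2 + 1 * y ^ 2 + 3 * z ^ 2 + 9 * w ^ 2 →
      ¬ (z % 2 = 0 ∧ w % 2 = 0) → ¬ (z % 2 = 1 ∧ w % 2 = 1) →
      z % 2 = 0 ∧ w % 2 = 1 ∧ (x + y) % 2 = 1 := by
    intro x y z w h _ _
    rcases sqCases x with hx | hx <;> rcases sqCases y with hy | hy <;>
    rcases sqCases z with hz | hz <;> rcases sqCases w with hw | hw <;> omega
  have par2 : ∀ x y z w : ℤ, m = 1 * x ^ 2 + 4 * y ^ 2 + 12 * z ^ 2 + 9 * w ^ 2 →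
      x % 2 = 1 ∧ w % 2 = 1 := by
    intro x y z w h
    rcases sqCases x with hx | hx <;> rcases sqCases w with hw | hw <;> omega
  have h7 : (Q 1 1 3 9 m ∩ {P | ¬ (P.2.2.1 % 2 = 0 ∧ P.2.2.2 % 2 = 0)}
      ∩ {P | ¬ (P.2.2.1 % 2 = 1 ∧ P.2.2.2 % 2 = 1)} ∩ {P | P.2.1 % 2 = 0}).ncard
      = (Q 1 4 12 9 m).ncard := by
    apply cardEq (fun P => (P.1, 2 * P.2.1, 2 * P.2.2.1, P.2.2.2))
    · rintro ⟨x, y, z, w⟩ h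
      simp only [Q, Set.mem_ofPred_eq, Set.mem_inter_iff] at h ⊢
      have := par2 x y z w h
      refine ⟨⟨⟨by rw [h]; ring, by omega⟩, by omega⟩, by omega⟩
    · rintro ⟨x, y, z, w⟩ ⟨x', y', z', w'⟩ h
      simp only [Prod.mk.injEq] at h ⊢
      omega
    · rintro ⟨x, y, z, w⟩ h
      simp only [Q, Set.mem_ofPred_eq, Set.mem_inter_iff] at h
      obtain ⟨⟨⟨h1, h2⟩, h3⟩, h4⟩ := h
      have := par x y z w h1 h2 h3
      obtain ⟨b, rfl⟩ : ∃ b, y = 2 * b := ⟨y / 2, by omega⟩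
      obtain ⟨c, rfl⟩ : ∃ c, z = 2 * c := ⟨z / 2, by omega⟩
      refine ⟨(x, b, c, w), ?_, rfl⟩
      simp only [Q, Set.mem_ofPred_eq]; rw [h1]; ring
  have h8 : (Q 1 1 3 9 m ∩ {P | ¬ (P.2.2.1 % 2 = 0 ∧ P.2.2.2 % 2 = 0)}
      ∩ {P | ¬ (P.2.2.1 % 2 = 1 ∧ P.2.2.2 % 2 = 1)} ∩ {P | ¬ P.2.1 % 2 = 0}).ncard
      = (Q 1 4 12 9 m).ncard := by
    apply cardEq (fun P => (2 * P.2.1, P.1, 2 * P.2.2.1, P.2.2.2))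
    · rintro ⟨x, y, z, w⟩ h
      simp only [Q, Set.mem_ofPred_eq, Set.mem_inter_iff] at h ⊢
      have := par2 x y z w h
      refine ⟨⟨⟨by rw [h]; ring, by omega⟩, by omega⟩, by omega⟩
    · rintro ⟨x, y, z, w⟩ ⟨x', y', z', w'⟩ h
      simp only [Prod.mk.injEq] at h ⊢
      omega
    · rintro ⟨x, y, z, w⟩ h
      simp only [Q, Set.mem_ofPred_eq, Set.mem_inter_iff] at h
      obtain ⟨⟨⟨h1, h2⟩, h3⟩, h4⟩ := h
      have := par x y z w h1 h2 h3
      obtain ⟨b, rfl⟩ : ∃ b, x = 2 * b := ⟨x / 2, by omega⟩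
      obtain ⟨c, rfl⟩ : ∃ c, z = 2 * c := ⟨z / 2, by omega⟩
      refine ⟨(y, b, c, w), ?_, rfl⟩
      simp only [Q, Set.mem_ofPred_eq]; rw [h1]; ring
  omega

theorem stmt7 (n : ℕ) (hn : 0 < n) :
    (N 2 2 3 9 (8 * n + 6) : ℚ) = 3 / 5 * (N 1 1 3 9 (8 * n + 6) : ℚ) := by
  have e1 : N 1 1 3 9 (8 * n + 6) = (Q 1 1 3 9 ((8 * n + 6 : ℕ) : ℤ)).ncard := rfl
  have e2 : N 2 2 3 9 (8 * n + 6) = (Q 2 2 3 9 ((8 * n + 6 : ℕ) : ℤ)).ncard := rfl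
  have hm : ((8 * n + 6 : ℕ) : ℤ) % 8 = 6 := by omega
  rw [e1, e2, N1 _ hm, N2 _ hm, rot _ hm]
  push_cast
  ring
end

section
/- Let a be an odd positive integer, let k, m be nonnegative integers, and let n be a positive integer with n ≡ k + (a−1)/2 (mod 2). Then t(a,3a,8k+4,4m+2;n) = (2/3)·N(a,3a,8k+4,4m+2; 8n+4m+8k+4a+6). -/
theorem odd_sq8 (x : ℤ) (h : x % 2 = 1) : ∃ p, x ^ 2 = 8 * p + 1 := by
  obtain ⟨p, hp⟩ := Int.eight_dvd_sq_sub_one_of_odd (Int.odd_iff.2 h)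
  exact ⟨p, by linarith⟩

theorem even_sq4 (x : ℤ) (h : x % 2 = 0) : x ^ 2 = 4 * (x / 2) ^ 2 := by
  obtain ⟨p, rfl⟩ : ∃ p, x = 2 * p := ⟨x / 2, by omega⟩
  have : 2 * p / 2 = p := by omega
  rw [this]; ring

theorem key8 (b k m s x y z w : ℤ)
    (h : 16 * s + 4 * m + 10 = (2 * b + 1) * x ^ 2 + 3 * (2 * b + 1) * y ^ 2
      + (8 * k + 4) * z ^ 2 + (4 * m + 2) * w ^ 2) :
    z % 2 = 1 ∧ w % 2 = 1 ∧ ((x % 2 = 1 ∧ y % 2 = 1) ∨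
      (x % 2 = 0 ∧ y % 2 = 0 ∧ (x / 2 + y / 2) % 2 = 1)) := by
  have hsq : ∀ u : ℤ, (u % 2 = 1 ∧ ∃ p, u ^ 2 = 8 * p + 1) ∨
      (u % 2 = 0 ∧ ∃ p, u ^ 2 = 4 * p ∧
        (((u / 2) % 2 = 0 ∧ ∃ q, p = 4 * q) ∨ ((u / 2) % 2 = 1 ∧ ∃ q, p = 8 * q + 1))) := by
    intro u
    rcases Int.emod_two_eq_zero_or_one u with hu | hu
    · right
      refine ⟨hu, (u / 2) ^ 2, even_sq4 u hu, ?_⟩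
      rcases Int.emod_two_eq_zero_or_one (u / 2) with hv | hv
      · left; exact ⟨hv, _, even_sq4 _ hv⟩
      · right; exact ⟨hv, odd_sq8 _ hv⟩
    · left; exact ⟨hu, odd_sq8 u hu⟩
  rcases hsq w with ⟨hw, W, hW⟩ | ⟨hw, W, hW, -⟩
  all_goals rcases hsq z with ⟨hz, Z, hZ⟩ | ⟨hz, Z, hZ, -⟩
  all_goals rcases hsq x with ⟨hx, X, hX⟩ | ⟨hx, X, hX, ⟨hx2, X', rfl⟩ | ⟨hx2, X', rfl⟩⟩
  all_goals rcases hsq y with ⟨hy, Y, hY⟩ | ⟨hy, Y, hY, ⟨hy2, Y', rfl⟩ | ⟨hy2, Y', rfl⟩⟩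
  all_goals rw [hX, hY, hZ, hW] at h
  all_goals clear hX hY hZ hW hsq
  all_goals ring_nf at h
  all_goals omega

theorem ncard_inv {α : Type*} (A B : Set α) (f : α → α) (hf : ∀ x ∈ A, f x ∈ B)
    (hg : ∀ x ∈ B, f x ∈ A) (h1 : ∀ x ∈ A, f (f x) = x) (h2 : ∀ x ∈ B, f (f x) = x) :
    A.ncard = B.ncard := by
  refine Set.ncard_congr (fun x _ => f x) hf ?_ ?_
  · intro x y hx hy h
    have := congrArg f h
    rwa [h1 x hx, h1 y hy] at this
  · intro y hy
    exact ⟨f y, hg y hy, h2 y hy⟩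

theorem fin8 (a b c d M : ℤ) (ha : 0 < a) (hb : 0 < b) (hc : 0 < c) (hd : 0 < d) :
    {P : ℤ × ℤ × ℤ × ℤ |
    M = a * P.1 ^ 2 + b * P.2.1 ^ 2 + c * P.2.2.1 ^ 2 + d * P.2.2.2 ^ 2}.Finite := by
  refine Set.Finite.subset (((Set.finite_Icc (-M) M).prod ((Set.finite_Icc (-M) M).prod
    ((Set.finite_Icc (-M) M).prod (Set.finite_Icc (-M) M))))) ?_
  rintro ⟨x, y, z, w⟩ h
  simp only [Set.mem_ofPred_eq] at h
  have e : ∀ (c u : ℤ), 0 < c → 0 ≤ c * u ^ 2 ∧ u ≤ c * u ^ 2 ∧ -u ≤ c * u ^ 2 := by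
    intro c u hc
    have h0 : u ^ 2 ≤ c * u ^ 2 := le_mul_of_one_le_left (sq_nonneg u) hc
    have h1 : u ≤ u ^ 2 := Int.le_self_sq u
    have h2 : -u ≤ (-u) ^ 2 := Int.le_self_sq (-u)
    have h3 : (-u) ^ 2 = u ^ 2 := by ring
    refine ⟨by positivity, by linarith, by linarith⟩
  have e1 := e a x ha
  have e2 := e b y hb
  have e3 := e c z hc
  have e4 := e d w hd
  simp only [Set.mem_prod, Set.mem_Icc]
  refine ⟨⟨?_, ?_⟩, ⟨?_, ?_⟩, ⟨?_, ?_⟩, ?_, ?_⟩ <;> linarith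

theorem tri8 (x : ℤ) : 8 * (x * (x - 1) / 2) = (2 * x - 1) ^ 2 - 1 := by
  have h : 2 * (x * (x - 1) / 2) = x * (x - 1) := by
    apply Int.mul_ediv_cancel'
    rcases Int.emod_two_eq_zero_or_one x with h | h
    · exact Dvd.dvd.mul_right (by omega) _
    · exact Dvd.dvd.mul_left (by omega) _
  linarith

theorem stmt8 (a k m : ℕ) (ha : 0 < a) (haodd : Odd a) (n : ℕ) (hn : 0 < n)
    (hcong : n % 2 = (k + (a - 1) / 2) % 2) :
    (t a (3 * a) (8 * k + 4) (4 * m + 2) n : ℚ)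
      = 2 / 3 * (N a (3 * a) (8 * k + 4) (4 * m + 2) (8 * n + 4 * m + 8 * k + 4 * a + 6) : ℚ) := by
  obtain ⟨b, rfl⟩ := haodd
  obtain ⟨s, hs⟩ : ∃ s, n + k + b = 2 * s := ⟨(n + k + b) / 2, by omega⟩
  have hsz : (n : ℤ) + k + b = 2 * s := by exact_mod_cast hs
  let S : Set (ℤ × ℤ × ℤ × ℤ) := {P | 16 * (s : ℤ) + 4 * m + 10 = (2 * b + 1) * P.1 ^ 2
    + 3 * (2 * b + 1) * P.2.1 ^ 2 + (8 * k + 4) * P.2.2.1 ^ 2 + (4 * m + 2) * P.2.2.2 ^ 2}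
  have hSfin : S.Finite := fin8 _ _ _ _ _ (by positivity) (by positivity) (by positivity)
    (by positivity)
  have hkey : ∀ P ∈ S, _ := fun P hP => key8 b k m s P.1 P.2.1 P.2.2.1 P.2.2.2 hP
  let E : Set (ℤ × ℤ × ℤ × ℤ) := {P | P ∈ S ∧ P.1 % 2 = 0}
  let O : Set (ℤ × ℤ × ℤ × ℤ) := {P | P ∈ S ∧ P.1 % 2 = 1}
  let A : Set (ℤ × ℤ × ℤ × ℤ) := {P | P ∈ S ∧ P.1 % 2 = 1 ∧ (P.1 - P.2.1) % 4 = 0}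
  let B : Set (ℤ × ℤ × ℤ × ℤ) := {P | P ∈ S ∧ P.1 % 2 = 1 ∧ (P.1 + P.2.1) % 4 = 0}
  have hN : N (2 * b + 1) (3 * (2 * b + 1)) (8 * k + 4) (4 * m + 2)
      (8 * n + 4 * m + 8 * k + 4 * (2 * b + 1) + 6) = S.ncard := by
    unfold N
    congr 1
    ext P
    simp only [Set.mem_ofPred_eq, S]
    push_cast
    constructor <;> intro h <;> linarith
  have hT : t (2 * b + 1) (3 * (2 * b + 1)) (8 * k + 4) (4 * m + 2) n = O.ncard := by
    unfold t
    refine Set.ncard_congr (fun P _ => (2 * P.1 - 1, 2 * P.2.1 - 1, 2 * P.2.2.1 - 1,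
      2 * P.2.2.2 - 1)) ?_ ?_ ?_
    · rintro ⟨x, y, z, w⟩ h
      simp only [Set.mem_ofPred_eq, S, O] at h ⊢
      push_cast at h
      refine ⟨?_, by omega⟩
      have h1 := tri8 x
      have h2 := tri8 y
      have h3 := tri8 z
      have h4 := tri8 w
      linear_combination 8 * h - 8 * hsz + (2 * b + 1 : ℤ) * h1 + 3 * (2 * b + 1 : ℤ) * h2
        + (8 * k + 4 : ℤ) * h3 + (4 * m + 2 : ℤ) * h4
    · rintro ⟨x, y, z, w⟩ ⟨x', y', z', w'⟩ - - h
      simp only [Prod.mk.injEq] at h ⊢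
      omega
    · rintro ⟨x, y, z, w⟩ ⟨hP, hx⟩
      have hk := hkey _ hP
      simp only at hk hx
      obtain ⟨x, rfl⟩ : ∃ u, x = 2 * u - 1 := ⟨(x + 1) / 2, by omega⟩
      obtain ⟨y, rfl⟩ : ∃ u, y = 2 * u - 1 := ⟨(y + 1) / 2, by omega⟩
      obtain ⟨z, rfl⟩ : ∃ u, z = 2 * u - 1 := ⟨(z + 1) / 2, by omega⟩
      obtain ⟨w, rfl⟩ : ∃ u, w = 2 * u - 1 := ⟨(w + 1) / 2, by omega⟩
      refine ⟨(x, y, z, w), ?_, rfl⟩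
      simp only [Set.mem_ofPred_eq, S] at hP ⊢
      push_cast
      have h1 := tri8 x
      have h2 := tri8 y
      have h3 := tri8 z
      have h4 := tri8 w
      have : (8 : ℤ) ≠ 0 := by norm_num
      apply mul_left_cancel₀ this
      linear_combination hP + 8 * hsz - (2 * b + 1 : ℤ) * h1 - 3 * (2 * b + 1 : ℤ) * h2
        - (8 * k + 4 : ℤ) * h3 - (4 * m + 2 : ℤ) * h4
  have hAB : A.ncard = B.ncard := by
    apply ncard_inv A B (fun P => (P.1, -P.2.1, P.2.2.1, P.2.2.2))
    · rintro ⟨x, y, z, w⟩ ⟨h1, h2, h3⟩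
      simp only [Set.mem_ofPred_eq, S, B] at h1 h2 h3 ⊢
      exact ⟨by linarith, h2, by omega⟩
    · rintro ⟨x, y, z, w⟩ ⟨h1, h2, h3⟩
      simp only [Set.mem_ofPred_eq, S, A] at h1 h2 h3 ⊢
      exact ⟨by linarith, h2, by omega⟩
    · intro P _; simp
    · intro P _; simp
  have hrot : ∀ x y z w : ℤ, (x - y) % 2 = 0 → (x, y, z, w) ∈ S →
      ((x + 3 * y) / 2, (x - y) / 2, z, w) ∈ S := by
    intro x y z w h hS
    obtain ⟨v, hv⟩ : ∃ v, x = y + 2 * v := ⟨(x - y) / 2, by omega⟩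
    have e1 : (x + 3 * y) / 2 = 2 * y + v := by omega
    have e2 : (x - y) / 2 = v := by omega
    rw [e1, e2]
    subst hv
    simp only [Set.mem_ofPred_eq, S] at hS ⊢
    linear_combination hS
  have hAE : A.ncard = E.ncard := by
    apply ncard_inv A E (fun P => ((P.1 + 3 * P.2.1) / 2, (P.1 - P.2.1) / 2, P.2.2.1, P.2.2.2))
    · clear hcong hs hsz hn ha hAB hN hT
      rintro ⟨x, y, z, w⟩ ⟨h1, h2, h3⟩
      simp only at h2 h3
      exact ⟨hrot x y z w (by omega) h1, by simp only; omega⟩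
    · clear hcong hs hsz hn ha hAB hN hT
      rintro ⟨x, y, z, w⟩ ⟨h1, h2⟩
      have hk := hkey _ h1
      simp only at h2 hk
      exact ⟨hrot x y z w (by omega) h1, by simp only; omega, by simp only; omega⟩
    · clear hcong hs hsz hn ha hAB hN hT
      rintro ⟨x, y, z, w⟩ ⟨h1, h2, h3⟩
      simp only [Prod.mk.injEq, and_true] at h2 h3 ⊢
      omega
    · clear hcong hs hsz hn ha hAB hN hT
      rintro ⟨x, y, z, w⟩ ⟨h1, h2⟩
      have hk := hkey _ h1
      simp only [Prod.mk.injEq, and_true] at h2 hk ⊢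
      omega
  have hO : O.ncard = A.ncard + B.ncard := by
    rw [← Set.ncard_union_eq ?_ (hSfin.subset fun P h => h.1) (hSfin.subset fun P h => h.1)]
    · congr 1
      ext P
      constructor
      · rintro ⟨h1, h2⟩
        have hk := hkey _ h1
        by_cases h : (P.1 - P.2.1) % 4 = 0
        · exact Or.inl ⟨h1, h2, h⟩
        · exact Or.inr ⟨h1, h2, by omega⟩
      · rintro (h | h)
        · exact ⟨h.1, h.2.1⟩
        · exact ⟨h.1, h.2.1⟩
    · rw [Set.disjoint_left]
      rintro P ⟨_, h2, h3⟩ ⟨_, _, h4⟩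
      omega
  have hS : S.ncard = O.ncard + E.ncard := by
    rw [← Set.ncard_union_eq ?_ (hSfin.subset fun P h => h.1) (hSfin.subset fun P h => h.1)]
    · congr 1
      ext P
      constructor
      · intro h1
        rcases Int.emod_two_eq_zero_or_one P.1 with h | h
        · exact Or.inr ⟨h1, h⟩
        · exact Or.inl ⟨h1, h⟩
      · rintro (h | h)
        · exact h.1
        · exact h.1
    · rw [Set.disjoint_left]
      rintro P ⟨_, h2⟩ ⟨_, h4⟩
      omega
  rw [hN, hT, hS, hO, ← hAB, ← hAE]
  push_cast
  ring
end

section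
/- Let a and k be positive integers with a odd. For every positive integer m, t(a,a,6a,4k; 4m+3a) = 2·t(a,a,6a,k; m). -/
def TT (x : ℤ) : ℤ := x * (x - 1) / 2

lemma TT_two (x : ℤ) : 2 * TT x = x * (x - 1) := by
  have h : Even (x * (x - 1)) := Int.even_mul_pred_self x
  exact Int.mul_ediv_cancel' h.two_dvd

lemma TT_mod (x : ℤ) : ((TT x : ℤ) : ZMod 4) =
    ((((x % 8) * (x % 8 - 1) / 2 : ℤ)) : ZMod 4) := by
  have h1 := TT_two x
  have h2 := TT_two (x % 8)
  have h3 := Int.emod_add_mul_ediv x 8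
  have : TT x - TT (x % 8) = 4 * ((x/8) * (2 * (x % 8) + 8 * (x/8) - 1)) := by
    generalize x / 8 = q at *
    generalize x % 8 = r at *
    subst h3
    linarith
  rw [← sub_eq_zero, ← Int.cast_sub, ZMod.intCast_zmod_eq_zero_iff_dvd]
  exact ⟨_, this⟩


def FF (p : (ℤ × ℤ × ℤ × ℤ) × Bool) : ℤ × ℤ × ℤ × ℤ :=
  if (p.1.1 - p.1.2.1) % 2 = 1 then
    ((3 * p.1.1 - p.1.2.1 + 6 * p.1.2.2.1 - 3) / 2,
     (-p.1.1 + 3 * p.1.2.1 + 6 * p.1.2.2.1 - 3) / 2,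
     ((if p.2 then p.1.1 + p.1.2.1 - 2 * p.1.2.2.1
       else -(p.1.1 + p.1.2.1 - 2 * p.1.2.2.1)) + 1) / 2, p.1.2.2.2)
  else
    ((3 * p.1.1 + p.1.2.1 + 6 * p.1.2.2.1 - 4) / 2,
     (p.1.1 + 3 * p.1.2.1 - 6 * p.1.2.2.1 + 2) / 2,
     ((if p.2 then p.1.1 - p.1.2.1 - 2 * p.1.2.2.1 + 1
       else -(p.1.1 - p.1.2.1 - 2 * p.1.2.2.1 + 1)) + 1) / 2, p.1.2.2.2)

lemma FF_inj : Function.Injective FF := by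
  rintro ⟨⟨x, y, z, w⟩, e⟩ ⟨⟨x', y', z', w'⟩, e'⟩ h
  unfold FF at h
  dsimp only at h
  cases e <;> cases e' <;> split_ifs at h <;>
    simp only [Prod.mk.injEq, reduceCtorEq, and_true, and_false, Bool.false_eq_true, if_true,
      if_false] at h ⊢ <;> first | omega | exact absurd rfl ‹¬ true = true›

lemma TT_key (x y z x' y' z' : ℤ)
    (h : (2*x-1)^2 + (2*y-1)^2 + 6*(2*z-1)^2
      = 4 * ((2*x'-1)^2 + (2*y'-1)^2 + 6*(2*z'-1)^2)) :
    TT x + TT y + 6 * TT z = 4 * (TT x' + TT y' + 6 * TT z') + 3 := by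
  linarith [TT_two x, TT_two y, TT_two z, TT_two x', TT_two y', TT_two z']

lemma FF_S (p : (ℤ × ℤ × ℤ × ℤ) × Bool) :
    TT (FF p).1 + TT (FF p).2.1 + 6 * TT (FF p).2.2.1
      = 4 * (TT p.1.1 + TT p.1.2.1 + 6 * TT p.1.2.2.1) + 3 := by
  obtain ⟨⟨x, y, z, w⟩, e⟩ := p
  apply TT_key
  unfold FF
  dsimp only
  split_ifs with h1 h2 h2 <;> dsimp only
  · rw [show 2 * ((3 * x - y + 6 * z - 3) / 2) = 3 * x - y + 6 * z - 3 by omega,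
      show 2 * ((-x + 3 * y + 6 * z - 3) / 2) = -x + 3 * y + 6 * z - 3 by omega,
      show 2 * ((x + y - 2 * z + 1) / 2) = x + y - 2 * z + 1 by omega]
    ring
  · rw [show 2 * ((3 * x - y + 6 * z - 3) / 2) = 3 * x - y + 6 * z - 3 by omega,
      show 2 * ((-x + 3 * y + 6 * z - 3) / 2) = -x + 3 * y + 6 * z - 3 by omega,
      show 2 * ((-(x + y - 2 * z) + 1) / 2) = -(x + y - 2 * z) + 1 by omega]
    ring
  · rw [show 2 * ((3 * x + y + 6 * z - 4) / 2) = 3 * x + y + 6 * z - 4 by omega,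
      show 2 * ((x + 3 * y - 6 * z + 2) / 2) = x + 3 * y - 6 * z + 2 by omega,
      show 2 * ((x - y - 2 * z + 1 + 1) / 2) = x - y - 2 * z + 1 + 1 by omega]
    ring
  · rw [show 2 * ((3 * x + y + 6 * z - 4) / 2) = 3 * x + y + 6 * z - 4 by omega,
      show 2 * ((x + 3 * y - 6 * z + 2) / 2) = x + 3 * y - 6 * z + 2 by omega,
      show 2 * ((-(x - y - 2 * z + 1) + 1) / 2) = -(x - y - 2 * z + 1) + 1 by omega]
    ring

lemma fin_check : ∀ p q r : Fin 8,
    ((((p.val : ℤ) * (p.val - 1) / 2 : ℤ)) + (((q.val : ℤ) * (q.val - 1) / 2 : ℤ))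
      + 6 * (((r.val : ℤ) * (r.val - 1) / 2 : ℤ))) % 4 = 3 →
    (((p.val : ℤ) - q.val) % 4 = 2 ∧ ((p.val : ℤ) + q.val - 1 - (2 * r.val - 1)) % 8 = 4) ∨
    (((p.val : ℤ) - q.val) % 4 = 2 ∧ ((p.val : ℤ) + q.val - 1 + (2 * r.val - 1)) % 8 = 4) ∨
    (((p.val : ℤ) + q.val - 1) % 4 = 2 ∧ ((p.val : ℤ) - q.val - (2 * r.val - 1)) % 8 = 4) ∨
    (((p.val : ℤ) + q.val - 1) % 4 = 2 ∧ ((p.val : ℤ) - q.val + (2 * r.val - 1)) % 8 = 4) := by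
  decide +kernel

lemma mod_check (x y z : ℤ) (h : (TT x + TT y + 6 * TT z) % 4 = 3) :
    ((x - y) % 4 = 2 ∧ (x + y - 1 - (2 * z - 1)) % 8 = 4) ∨
    ((x - y) % 4 = 2 ∧ (x + y - 1 + (2 * z - 1)) % 8 = 4) ∨
    ((x + y - 1) % 4 = 2 ∧ (x - y - (2 * z - 1)) % 8 = 4) ∨
    ((x + y - 1) % 4 = 2 ∧ (x - y + (2 * z - 1)) % 8 = 4) := by
  have hx := TT_mod x
  have hy := TT_mod y
  have hz := TT_mod z
  rw [ZMod.intCast_eq_intCast_iff'] at hx hy hz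
  have := fin_check ⟨(x % 8).toNat, by omega⟩ ⟨(y % 8).toNat, by omega⟩ ⟨(z % 8).toNat, by omega⟩
  dsimp only at this
  rw [Int.toNat_of_nonneg (by omega), Int.toNat_of_nonneg (by omega),
    Int.toNat_of_nonneg (by omega)] at this
  generalize (x % 8) * (x % 8 - 1) / 2 = A at *
  generalize (y % 8) * (y % 8 - 1) / 2 = B at *
  generalize (z % 8) * (z % 8 - 1) / 2 = C at *
  have := this (by push_cast at hx hy hz; omega)
  omega

lemma FF_surj (x y z w : ℤ) (h : (TT x + TT y + 6 * TT z) % 4 = 3) :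
    ∃ p, FF p = (x, y, z, w) := by
  rcases mod_check x y z h with h | h | h | h
  · obtain ⟨Q, hQ⟩ : ∃ Q, x + y - 1 - (2 * z - 1) = 4 * Q := ⟨(x + y - 1 - (2 * z - 1)) / 4, by omega⟩
    obtain ⟨R, hR⟩ : ∃ R, x - y = 2 * R := ⟨(x - y) / 2, by omega⟩
    refine ⟨(((Q + (2*z-1) + R + 1) / 2, (Q + (2*z-1) - R + 1) / 2, (Q + 1) / 2, w), true), ?_⟩
    unfold FF
    dsimp only
    rw [if_pos (by omega)]
    simp only [Prod.mk.injEq, and_true, if_true]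
    omega
  · obtain ⟨Q, hQ⟩ : ∃ Q, x + y - 1 + (2 * z - 1) = 4 * Q := ⟨(x + y - 1 + (2 * z - 1)) / 4, by omega⟩
    obtain ⟨R, hR⟩ : ∃ R, x - y = 2 * R := ⟨(x - y) / 2, by omega⟩
    refine ⟨(((Q - (2*z-1) + R + 1) / 2, (Q - (2*z-1) - R + 1) / 2, (Q + 1) / 2, w), false), ?_⟩
    unfold FF
    dsimp only
    rw [if_pos (by omega)]
    simp only [Prod.mk.injEq, and_true, Bool.false_eq_true, if_false]
    omega
  · obtain ⟨Q, hQ⟩ : ∃ Q, x - y - (2 * z - 1) = 4 * Q := ⟨(x - y - (2 * z - 1)) / 4, by omega⟩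
    obtain ⟨R, hR⟩ : ∃ R, x + y - 1 = 2 * R := ⟨(x + y - 1) / 2, by omega⟩
    refine ⟨(((Q + (2*z-1) + R + 1) / 2, (R - (Q + (2*z-1)) + 1) / 2, (Q + 1) / 2, w), true), ?_⟩
    unfold FF
    dsimp only
    rw [if_neg (by omega)]
    simp only [Prod.mk.injEq, and_true, if_true]
    omega
  · obtain ⟨Q, hQ⟩ : ∃ Q, x - y + (2 * z - 1) = 4 * Q := ⟨(x - y + (2 * z - 1)) / 4, by omega⟩
    obtain ⟨R, hR⟩ : ∃ R, x + y - 1 = 2 * R := ⟨(x + y - 1) / 2, by omega⟩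
    refine ⟨(((Q - (2*z-1) + R + 1) / 2, (R - (Q - (2*z-1)) + 1) / 2, (Q + 1) / 2, w), false), ?_⟩
    unfold FF
    dsimp only
    rw [if_neg (by omega)]
    simp only [Prod.mk.injEq, and_true, Bool.false_eq_true, if_false]
    omega

lemma FF_w (p : (ℤ × ℤ × ℤ × ℤ) × Bool) : (FF p).2.2.2 = p.1.2.2.2 := by
  unfold FF
  split_ifs <;> rfl

theorem stmt9 (a k : ℕ) (ha : 0 < a) (hk : 0 < k) (haodd : Odd a)
    (m : ℕ) (hm : 0 < m) :
    t a a (6 * a) (4 * k) (4 * m + 3 * a) = 2 * t a a (6 * a) k m := by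
  have key : ∀ p, (((4 * m + 3 * a : ℕ) : ℤ) = a * TT (FF p).1 + a * TT (FF p).2.1
      + ((6 * a : ℕ) : ℤ) * TT (FF p).2.2.1 + ((4 * k : ℕ) : ℤ) * TT (FF p).2.2.2) ↔
      ((m : ℤ) = a * TT p.1.1 + a * TT p.1.2.1
      + ((6 * a : ℕ) : ℤ) * TT p.1.2.2.1 + (k : ℤ) * TT p.1.2.2.2) := by
    intro p
    have h := FF_S p
    rw [FF_w]
    push_cast
    constructor
    · intro h2
      have : (4 : ℤ) * m = 4 * (a * TT p.1.1 + a * TT p.1.2.1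
        + (6 * a) * TT p.1.2.2.1 + k * TT p.1.2.2.2) := by
        linear_combination h2 + a * h
      linarith
    · intro h2
      linear_combination 4 * h2 - a * h
  unfold t
  set A := {P : ℤ × ℤ × ℤ × ℤ | ((4 * m + 3 * a : ℕ) : ℤ) = a * (P.1 * (P.1 - 1) / 2)
      + a * (P.2.1 * (P.2.1 - 1) / 2) + ((6 * a : ℕ) : ℤ) * (P.2.2.1 * (P.2.2.1 - 1) / 2)
      + ((4 * k : ℕ) : ℤ) * (P.2.2.2 * (P.2.2.2 - 1) / 2)} with hA
  set B := {P : ℤ × ℤ × ℤ × ℤ | (m : ℤ) = a * (P.1 * (P.1 - 1) / 2)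
      + a * (P.2.1 * (P.2.1 - 1) / 2) + ((6 * a : ℕ) : ℤ) * (P.2.2.1 * (P.2.2.1 - 1) / 2)
      + (k : ℤ) * (P.2.2.2 * (P.2.2.2 - 1) / 2)} with hB
  have him : A = FF '' (B ×ˢ (Set.univ : Set Bool)) := by
    ext P
    constructor
    · intro hP
      obtain ⟨x, y, z, w⟩ := P
      have hP' : ((4 * m + 3 * a : ℕ) : ℤ) = a * TT x + a * TT y
        + ((6 * a : ℕ) : ℤ) * TT z + ((4 * k : ℕ) : ℤ) * TT w := hP
      have hmod : (TT x + TT y + 6 * TT z) % 4 = 3 := by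
        have hd : (4 : ℤ) ∣ a * (TT x + TT y + 6 * TT z - 3) := by
          refine ⟨m - k * TT w, ?_⟩
          push_cast at hP'
          linear_combination -hP'
        have hc : IsCoprime (4 : ℤ) a := by
          have : Nat.Coprime 4 a := by
            have h2 : Nat.Coprime 2 a := (Nat.coprime_two_left).2 haodd
            exact Nat.Coprime.pow_left 2 h2
          exact_mod_cast Nat.isCoprime_iff_coprime.2 this
        have := hc.dvd_of_dvd_mul_left hd
        omega
      obtain ⟨p, hp⟩ := FF_surj x y z w hmod
      refine ⟨p, ⟨(key p).1 ?_, Set.mem_univ _⟩, hp⟩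
      rw [hp]
      exact hP'
    · rintro ⟨p, ⟨hp, -⟩, rfl⟩
      exact (key p).2 hp
  rw [him, Set.ncard_image_of_injective _ FF_inj, Set.ncard_prod, Set.ncard_univ]
  simp [mul_comm]
end

section
/- Let a and k be positive integers with a odd. For every positive integer m, t(a,a,2a,4k; 4m+3a) = 4·t(a,2a,4a,k; m). -/
/-- the map giving the four-to-one correspondence -/
def fmap (Q : (Bool × Bool) × (ℤ × ℤ × ℤ × ℤ)) : ℤ × ℤ × ℤ × ℤ :=
  match Q with
  | ((true, true), (p, q, r, w)) => (p - 2*r + 2*q, p - 2*r - 2*q + 2, p + 2*r - 1, w)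
  | ((true, false), (p, q, r, w)) => (p - 2*r + 2*q, 1 - (p - 2*r - 2*q + 2), p + 2*r - 1, w)
  | ((false, true), (p, q, r, w)) => (-p + 2*r + 2*q - 1, -p + 2*r - 2*q + 1, p + 2*r - 1, w)
  | ((false, false), (p, q, r, w)) =>
      (-p + 2*r + 2*q - 1, 1 - (-p + 2*r - 2*q + 1), p + 2*r - 1, w)

theorem fmap_inj : Function.Injective fmap := by
  rintro ⟨⟨e, d⟩, p, q, r, w⟩ ⟨⟨e', d'⟩, p', q', r', w'⟩ h
  cases e <;> cases d <;> cases e' <;> cases d' <;>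
    simp only [fmap, Prod.mk.injEq] at h ⊢ <;> obtain ⟨h1, h2, h3, h4⟩ := h <;>
    first
      | (exfalso; omega)
      | (refine ⟨trivial, ?_, ?_, ?_, ?_⟩ <;> omega)

theorem two_tri (x : ℤ) : 2 * (x * (x - 1) / 2) = x * (x - 1) := by
  apply Int.mul_ediv_cancel'
  have := (Int.even_mul_pred_self x)
  exact this.two_dvd

set_option maxRecDepth 100000 in
theorem zmod_fact : ∀ x y z : ZMod 8, x * (x-1) + y * (y-1) + 2 * (z * (z-1)) = 6 →
    (2*(x-y-2) = 0 ∧ 2*(2*z-1+(x+y-1)-2) = 0 ∧ 2*z-1-(x+y-1)-4 = 0) ∨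
    (2*(x-(1-y)-2) = 0 ∧ 2*(2*z-1+(x+(1-y)-1)-2) = 0 ∧ 2*z-1-(x+(1-y)-1)-4 = 0) ∨
    (2*(x-y-2) = 0 ∧ 2*(2*z-1-(x+y-1)-2) = 0 ∧ 2*z-1+(x+y-1)-4 = 0) ∨
    (2*(x-(1-y)-2) = 0 ∧ 2*(2*z-1-(x+(1-y)-1)-2) = 0 ∧ 2*z-1+(x+(1-y)-1)-4 = 0) := by
  decide

theorem int_fact (x y z : ℤ) (h : (8:ℤ) ∣ x * (x-1) + y * (y-1) + 2 * (z * (z-1)) - 6) :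
    (8 ∣ 2*(x-y-2) ∧ 8 ∣ 2*(2*z-1+(x+y-1)-2) ∧ 8 ∣ 2*z-1-(x+y-1)-4) ∨
    (8 ∣ 2*(x-(1-y)-2) ∧ 8 ∣ 2*(2*z-1+(x+(1-y)-1)-2) ∧ 8 ∣ 2*z-1-(x+(1-y)-1)-4) ∨
    (8 ∣ 2*(x-y-2) ∧ 8 ∣ 2*(2*z-1-(x+y-1)-2) ∧ 8 ∣ 2*z-1+(x+y-1)-4) ∨
    (8 ∣ 2*(x-(1-y)-2) ∧ 8 ∣ 2*(2*z-1-(x+(1-y)-1)-2) ∧ 8 ∣ 2*z-1+(x+(1-y)-1)-4) := by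
  have key : ∀ u : ℤ, (8:ℤ) ∣ u ↔ ((u : ℤ) : ZMod 8) = 0 := fun u => by
    rw [ZMod.intCast_zmod_eq_zero_iff_dvd u 8]; rfl
  have h2 := zmod_fact x y z (by
    rw [key] at h
    push_cast at h
    exact sub_eq_zero.mp h)
  simp only [key]
  push_cast
  exact h2

theorem fmap_surj (x y z w : ℤ) (h : (8:ℤ) ∣ x * (x-1) + y * (y-1) + 2 * (z * (z-1)) - 6) :
    ∃ Q, fmap Q = (x, y, z, w) := by
  rcases int_fact x y z h with ⟨h1, h2, h3⟩ | ⟨h1, h2, h3⟩ | ⟨h1, h2, h3⟩ | ⟨h1, h2, h3⟩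
  · refine ⟨((true, true), ((2*z-1+(x+y-1)+2)/4, (x-y+2)/4, (2*z-1-(x+y-1)+4)/8, w)), ?_⟩
    simp only [fmap, Prod.mk.injEq]
    refine ⟨?_, ?_, ?_, trivial⟩ <;> omega
  · refine ⟨((true, false), ((2*z-1+(x+(1-y)-1)+2)/4, (x-(1-y)+2)/4,
      (2*z-1-(x+(1-y)-1)+4)/8, w)), ?_⟩
    simp only [fmap, Prod.mk.injEq]
    refine ⟨?_, ?_, ?_, trivial⟩ <;> omega
  · refine ⟨((false, true), ((2*z-1-(x+y-1)+2)/4, (x-y+2)/4, (2*z-1+(x+y-1)+4)/8, w)), ?_⟩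
    simp only [fmap, Prod.mk.injEq]
    refine ⟨?_, ?_, ?_, trivial⟩ <;> omega
  · refine ⟨((false, false), ((2*z-1-(x+(1-y)-1)+2)/4, (x-(1-y)+2)/4,
      (2*z-1+(x+(1-y)-1)+4)/8, w)), ?_⟩
    simp only [fmap, Prod.mk.injEq]
    refine ⟨?_, ?_, ?_, trivial⟩ <;> omega

theorem form_iff (a b c d n x y z w : ℤ) :
    n = a * (x * (x - 1) / 2) + b * (y * (y - 1) / 2) + c * (z * (z - 1) / 2)
      + d * (w * (w - 1) / 2) ↔
    2 * n = a * (x * (x - 1)) + b * (y * (y - 1)) + c * (z * (z - 1)) + d * (w * (w - 1)) := by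
  have h1 := two_tri x
  have h2 := two_tri y
  have h3 := two_tri z
  have h4 := two_tri w
  constructor
  · intro h
    linear_combination 2 * h + a * h1 + b * h2 + c * h3 + d * h4
  · intro h
    apply mul_left_cancel₀ (two_ne_zero (α := ℤ))
    linear_combination h - a * h1 - b * h2 - c * h3 - d * h4

theorem stmt10 (a k : ℕ) (ha : 0 < a) (hk : 0 < k) (haodd : Odd a)
    (m : ℕ) (hm : 0 < m) :
    t a a (2 * a) (4 * k) (4 * m + 3 * a) = 4 * t a (2 * a) (4 * a) k m := by
  unfold t
  simp only [form_iff]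
  push_cast
  set S : Set (ℤ × ℤ × ℤ × ℤ) := {P | 2 * (m : ℤ) = a * (P.1 * (P.1 - 1))
    + 2 * a * (P.2.1 * (P.2.1 - 1)) + 4 * a * (P.2.2.1 * (P.2.2.1 - 1))
    + k * (P.2.2.2 * (P.2.2.2 - 1))} with hS
  have hmem : ∀ Q : (Bool × Bool) × (ℤ × ℤ × ℤ × ℤ), Q.2 ∈ S ↔
      2 * (4 * (m : ℤ) + 3 * a) = a * ((fmap Q).1 * ((fmap Q).1 - 1))
      + a * ((fmap Q).2.1 * ((fmap Q).2.1 - 1)) + 2 * a * ((fmap Q).2.2.1 * ((fmap Q).2.2.1 - 1))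
      + 4 * k * ((fmap Q).2.2.2 * ((fmap Q).2.2.2 - 1)) := by
    rintro ⟨⟨e, d⟩, p, q, r, w⟩
    cases e <;> cases d <;> simp only [fmap, hS, Set.mem_ofPred_eq] <;>
    · constructor
      · intro h
        linear_combination 4 * h
      · intro h
        apply mul_left_cancel₀ (four_ne_zero (α := ℤ))
        linear_combination h
  have himg : {P : ℤ × ℤ × ℤ × ℤ | 2 * (4 * (m : ℤ) + 3 * a) = a * (P.1 * (P.1 - 1))
      + a * (P.2.1 * (P.2.1 - 1)) + 2 * a * (P.2.2.1 * (P.2.2.1 - 1))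
      + 4 * k * (P.2.2.2 * (P.2.2.2 - 1))} = fmap '' ((Set.univ : Set (Bool × Bool)) ×ˢ S) := by
    ext ⟨x, y, z, w⟩
    constructor
    · intro h
      have h' := h
      simp only [Set.mem_ofPred_eq] at h'
      have hd : (8:ℤ) ∣ x * (x-1) + y * (y-1) + 2 * (z * (z-1)) - 6 := by
        have hc : IsCoprime (8:ℤ) (a:ℤ) := by
          have : Nat.Coprime 8 a := by
            have h2 : Nat.Coprime 2 a := (Nat.coprime_two_left).2 haodd
            exact Nat.Coprime.pow_left 3 h2
          exact_mod_cast Nat.isCoprime_iff_coprime.2 this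
        apply hc.dvd_of_dvd_mul_left
        refine ⟨m - k * (w * (w - 1) / 2), ?_⟩
        linear_combination -h' + 4 * k * two_tri w
      obtain ⟨Q, hQ⟩ := fmap_surj x y z w hd
      refine ⟨Q, ⟨Set.mem_univ _, (hmem Q).2 ?_⟩, hQ⟩
      rw [hQ]
      exact h
    · rintro ⟨Q, ⟨-, hQ⟩, hx⟩
      rw [← hx]
      exact (hmem Q).1 hQ
  rw [himg, Set.ncard_image_of_injective _ fmap_inj, Set.ncard_prod, Set.ncard_univ]
  simp
end
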